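/- arXiv:1007.5440 — 3 statements merged into one kernel-verified Lean document; each statement's English description precedes it below -/
import Mathlib

section
/- Let k be a field with char(k) ≠ 2, let C = V_+(F) ⊆ P^2 be a smooth conic, and let I ⊆ P = k[z_{ij} : 0 ≤ i ≤ 2, 0 ≤ j ≤ m] be the ideal defining the Segre product X = C × P^m ⊆ P^{3m+2}. Then ara_h(I) = 3m. In particular, X is a set-theoretic complete intersection if and only if m = 1. Moreover, if char(k) = 0, then ara(I) = ara_h(I) = 3m. -/
/-!
STATEMENT 14: Let `k` be a field with `char k ≠ 2`, let `C = V₊(F) ⊆ ℙ²` be a smooth conic,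
and let `I ⊆ P = k[z_{ij} : 0 ≤ i ≤ 2, 0 ≤ j ≤ m]` be the ideal defining the Segre product
`X = C × ℙᵐ ⊆ ℙ^{3m+2}`.  Then `ara_h(I) = 3m`.  In particular, `X` is a set-theoretic
complete intersection if and only if `m = 1`.  Moreover, if `char k = 0`, then
`ara(I) = ara_h(I) = 3m`.

`X = C × ℙᵐ` is a set-theoretic complete intersection exactly when `ara_h(I)` equals the
height of `I`, i.e. the codimension `(3m+2) − (m+1) = 2m+1` of `X` in `ℙ^{3m+2}`.
-/

open MvPolynomial

/-- The ideal of `P = k[z_{ij}]` defining the Segre product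
`V₊(a) × V₊(b) ⊆ ℙ^{nm+n+m}`: the kernel of the map `z_{ij} ↦ x_i y_j (mod a,b)`. -/
noncomputable def segreIdeal (k : Type*) [Field k] (n m : ℕ)
    (a : Ideal (MvPolynomial (Fin (n+1)) k)) (b : Ideal (MvPolynomial (Fin (m+1)) k)) :
    Ideal (MvPolynomial (Fin (n+1) × Fin (m+1)) k) :=
  RingHom.ker (MvPolynomial.aeval (R := k) (fun p : Fin (n+1) × Fin (m+1) =>
    Ideal.Quotient.mk
      (a.map (MvPolynomial.rename (Sum.inl : Fin (n+1) → Fin (n+1) ⊕ Fin (m+1)))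
        ⊔ b.map (MvPolynomial.rename (Sum.inr : Fin (m+1) → Fin (n+1) ⊕ Fin (m+1))))
      (X (Sum.inl p.1) * X (Sum.inr p.2))))

/-- arithmetical rank -/
noncomputable def ara {R : Type*} [CommRing R] (I : Ideal R) : ℕ :=
  sInf {t | ∃ f : Fin t → R, (Ideal.span (Set.range f)).radical = I.radical}

/-- homogeneous arithmetical rank -/
noncomputable def araH {k : Type*} [CommRing k] {σ : Type*} (I : Ideal (MvPolynomial σ k)) : ℕ :=
  sInf {t | ∃ f : Fin t → MvPolynomial σ k, (∀ i, ∃ d, (f i).IsHomogeneous d) ∧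
    (Ideal.span (Set.range f)).radical = I.radical}

/-- smoothness of the projective hypersurface `V₊(F) ⊆ ℙⁿ` over a field `k`:
the Jacobian criterion over the algebraic closure. -/
def IsSmoothHypersurface {k : Type*} [Field k] {n : ℕ}
    (F : MvPolynomial (Fin (n+1)) k) : Prop :=
  ∀ v : Fin (n+1) → AlgebraicClosure k, v ≠ 0 →
    ¬ (MvPolynomial.eval v (F.map (algebraMap k (AlgebraicClosure k))) = 0 ∧
       ∀ i, MvPolynomial.eval v
          ((MvPolynomial.pderiv i F).map (algebraMap k (AlgebraicClosure k))) = 0)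

theorem mul_det_mem_of_mulVec_mem {R ι : Type*} [CommRing R] [Fintype ι] [DecidableEq ι]
    (M : Matrix ι ι R) (x : ι → R) (J : Ideal R) (hM : ∀ k, M.mulVec x k ∈ J) (j : ι) :
    x j * M.det ∈ J := by
  have h : M.adjugate.mulVec (M.mulVec x) j = x j * M.det := by
    rw [Matrix.mulVec_mulVec, Matrix.adjugate_mul, Matrix.smul_mulVec, Matrix.one_mulVec]
    simp [mul_comm]
  rw [← h]
  exact J.sum_mem fun k _ => J.mul_mem_left _ (hM k)

theorem det_updateRow_mul_prod_mem {R ι : Type*} [CommRing R] [Fintype ι] [DecidableEq ι]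
    (M Φ : Matrix ι ι R) (x y u : ι → R) (i : ι) (hΦ : Φ.mulVec x = y)
    (hM : ∀ k, k ≠ i → M.mulVec x k = y k) (hu : u ⬝ᵥ x = 0) :
    (M.updateRow i u).det * ∏ k, y k ∈ Ideal.span (Set.range fun k => y k ^ 2) := by
  set J : Ideal R := Ideal.span (Set.range fun k => y k ^ 2)
  have key : ∀ z ∈ Ideal.span (y '' {i}ᶜ), z * ∏ k ∈ Finset.univ.erase i, y k ∈ J := by
    intro z hz
    induction hz using Submodule.span_induction with
    | mem z hz =>
      obtain ⟨k, hk, rfl⟩ := hz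
      have hk' : k ∈ Finset.univ.erase i := by simpa using hk
      rw [← Finset.mul_prod_erase _ _ hk', ← mul_assoc, ← sq]
      exact J.mul_mem_right _ (Ideal.subset_span ⟨k, rfl⟩)
    | zero => simp
    | add a b _ _ ha hb => rw [add_mul]; exact J.add_mem ha hb
    | smul c a _ ha => rw [smul_eq_mul, mul_assoc]; exact J.mul_mem_left _ ha
  have hx : ∀ j, x j * (M.updateRow i u).det ∈ Ideal.span (y '' {i}ᶜ) := by
    refine mul_det_mem_of_mulVec_mem _ _ _ fun k => ?_
    by_cases hk : k = i
    · subst hk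
      have : (M.updateRow k u).mulVec x k = u ⬝ᵥ x := by
        simp [Matrix.mulVec]
      rw [this, hu]
      exact zero_mem _
    · have : (M.updateRow i u).mulVec x k = M.mulVec x k := by
        simp [Matrix.mulVec, Matrix.updateRow_ne hk]
      rw [this, hM k hk]
      exact Ideal.subset_span ⟨k, hk, rfl⟩
  have hy : y i * (M.updateRow i u).det ∈ Ideal.span (y '' {i}ᶜ) := by
    rw [← hΦ, Matrix.mulVec, dotProduct, Finset.sum_mul]
    refine Ideal.sum_mem _ fun j _ => ?_
    rw [mul_assoc, ← hΦ] at *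
    exact Ideal.mul_mem_left _ _ (by simpa [hΦ] using hx j)
  have := key _ hy
  rwa [mul_comm (y i), mul_assoc, Finset.mul_prod_erase _ _ (Finset.mem_univ i)] at this

theorem det_sub_det_mul_prod_mem {R ι : Type*} [CommRing R] [Fintype ι] [DecidableEq ι]
    (Φ Φ' : Matrix ι ι R) (x y : ι → R) (hΦ : Φ.mulVec x = y) (hΦ' : Φ'.mulVec x = y) :
    (Φ'.det - Φ.det) * ∏ i, y i ∈ Ideal.span (Set.range fun i => y i ^ 2) := by
  set J : Ideal R := Ideal.span (Set.range fun k => y k ^ 2)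
  let M : Finset ι → Matrix ι ι R := fun s => Matrix.of fun i => if i ∈ s then Φ' i else Φ i
  have hM : ∀ s, (M s).mulVec x = y := by
    intro s
    funext i
    by_cases hi : i ∈ s
    · rw [← hΦ']; simp [M, Matrix.mulVec, hi]
    · rw [← hΦ]; simp [M, Matrix.mulVec, hi]
  have main : ∀ s : Finset ι, ((M s).det - Φ.det) * ∏ i, y i ∈ J := by
    intro s
    induction s using Finset.induction_on with
    | empty =>
      have : M ∅ = Φ := by ext; simp [M]
      simp [this]
    | insert i s hi ih =>
      have h1 : M (insert i s) = (M s).updateRow i (Φ i + (Φ' i - Φ i)) := by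
        ext a b
        by_cases ha : a = i
        · subst ha; simp [M]
        · simp [M, ha]
      have h2 : (M s).updateRow i (Φ i) = M s := by
        ext a b
        by_cases ha : a = i
        · subst ha; simp [M, hi]
        · simp [ha]
      have hu : (Φ' i - Φ i) ⬝ᵥ x = 0 := by
        rw [sub_dotProduct]
        exact sub_eq_zero.2 (congrFun (hΦ'.trans hΦ.symm) i)
      rw [h1, Matrix.det_updateRow_add, h2, add_sub_right_comm, add_mul]
      exact J.add_mem ih
        (det_updateRow_mul_prod_mem _ Φ x y _ i hΦ (fun k _ => congrFun (hM s) k) hu)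
  have hU : M Finset.univ = Φ' := by ext; simp [M]
  simpa [hU] using main Finset.univ

/-- If the powers `h i ^ T` lie in an ideal generated by fewer elements of `(h)`, then the
monomial conjecture fails for the sequence `h`. -/
theorem prod_pow_mem_span_pow {R ι : Type*} [CommRing R] [Fintype ι] [DecidableEq ι]
    (h f : ι → R) (i₀ : ι) (hf₀ : f i₀ = 0) (hf : ∀ i, f i ∈ Ideal.span (Set.range h))
    (T : ℕ) (hT : 1 ≤ T) (hh : ∀ i, h i ^ T ∈ Ideal.span (Set.range f)) :
    ∏ i, h i ^ (2 * T - 1) ∈ Ideal.span (Set.range fun i => h i ^ (2 * T)) := by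
  have hf' : ∀ i, ∃ c : ι → R, ∑ j, c j * h j = f i := fun i =>
    (Ideal.mem_span_range_iff_exists_fun).1 (hf i)
  choose Θ hΘ using hf'
  have hh' : ∀ i, ∃ c : ι → R, ∑ j, c j * f j = h i ^ T := fun i =>
    (Ideal.mem_span_range_iff_exists_fun).1 (hh i)
  choose Ψ hΨ using hh'
  let Θ' : Matrix ι ι R := (Matrix.of Θ).updateRow i₀ 0
  have hΘ' : Θ'.mulVec h = f := by
    funext i
    by_cases hi : i = i₀
    · subst hi; simp [Θ', Matrix.mulVec, hf₀]
    · rw [← hΘ]; simp [Θ', Matrix.mulVec, hi, dotProduct]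
  have h1 : (Matrix.of Ψ * Θ').mulVec h = fun i => h i ^ T := by
    rw [← Matrix.mulVec_mulVec, hΘ']
    funext i
    rw [← hΨ]
    rfl
  have h2 : (Matrix.diagonal fun i => h i ^ (T - 1)).mulVec h = fun i => h i ^ T := by
    funext i
    rw [Matrix.mulVec_diagonal, ← pow_succ, Nat.sub_add_cancel hT]
  have h3 : (Matrix.of Ψ * Θ').det = 0 := by
    rw [Matrix.det_mul, Matrix.det_eq_zero_of_row_eq_zero (A := Θ') i₀ (by simp [Θ']), mul_zero]
  have := det_sub_det_mul_prod_mem _ _ _ _ h1 h2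
  rw [h3, sub_zero, Matrix.det_diagonal, ← Finset.prod_mul_distrib] at this
  have e1 : ∀ i, h i ^ (T - 1) * h i ^ T = h i ^ (2 * T - 1) := fun i => by
    rw [← pow_add]; congr 1; omega
  simpa only [e1, ← pow_mul, mul_comm T 2] using this

theorem Matrix.det_mul_eq_zero_of_succ {R : Type*} [CommRing R] {n : ℕ}
    (A : Matrix (Fin (n + 1)) (Fin n) R) (B : Matrix (Fin n) (Fin (n + 1)) R) :
    (A * B).det = 0 := by
  let A' : Matrix (Fin (n + 1)) (Fin (n + 1)) R := Matrix.of fun i => Fin.snoc (A i) 0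
  let B' : Matrix (Fin (n + 1)) (Fin (n + 1)) R := Matrix.of (Fin.snoc B.row 0)
  have h : A * B = A' * B' := by
    ext i j
    simp [Matrix.mul_apply, Fin.sum_univ_castSucc, A', B']
  rw [h, Matrix.det_mul, Matrix.det_eq_zero_of_column_eq_zero (A := A') (Fin.last n)
    (by simp [A']), zero_mul]

/-- The diagonal entries and the sums along antidiagonals of a square array. -/
def diagFamily {R : Type*} [CommRing R] {m : ℕ} (q : Fin (m + 1) → Fin (m + 1) → R) :
    Fin (m + 1) ⊕ Fin (2 * m - 1) → R :=
  Sum.elim (fun i => q i i) fun l =>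
    ∑ p : Fin (m + 1) × Fin (m + 1),
      if p.1 < p.2 ∧ p.1.val + p.2.val = l.val + 1 then q p.1 p.2 else 0

theorem diagFamily_map {R S : Type*} [CommRing R] [CommRing S] {m : ℕ} (φ : R →+* S)
    (q : Fin (m + 1) → Fin (m + 1) → R) (i : Fin (m + 1) ⊕ Fin (2 * m - 1)) :
    φ (diagFamily q i) = diagFamily (fun a b => φ (q a b)) i := by
  cases i <;> simp [diagFamily, map_sum, apply_ite φ]

theorem diagFamily_mem {R : Type*} [CommRing R] {m : ℕ} (J : Ideal R)
    (q : Fin (m + 1) → Fin (m + 1) → R) (hq : ∀ a b, q a b ∈ J)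
    (i : Fin (m + 1) ⊕ Fin (2 * m - 1)) : diagFamily q i ∈ J := by
  cases i with
  | inl i => exact hq i i
  | inr l =>
    refine J.sum_mem fun p _ => ?_
    split_ifs
    exacts [hq _ _, J.zero_mem]

theorem diagFamily_mul {R : Type*} [CommRing R] {m : ℕ} (c : R)
    (q : Fin (m + 1) → Fin (m + 1) → R) (i : Fin (m + 1) ⊕ Fin (2 * m - 1)) :
    diagFamily (fun a b => c * q a b) i = c * diagFamily q i := by
  cases i <;> simp [diagFamily, Finset.mul_sum]

theorem eq_zero_of_diagFamily_eq_zero {R : Type*} [CommRing R] [IsDomain R] {m : ℕ}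
    (q : Fin (m + 1) → Fin (m + 1) → R) (hs : ∀ i j, q i j = q j i)
    (hdet : ∀ e : Fin 4 → Fin (m + 1), (Matrix.of fun a b => q (e a) (e b)).det = 0)
    (h : ∀ i, diagFamily q i = 0) (i j : Fin (m + 1)) : q i j = 0 := by
  have hd : ∀ i, q i i = 0 := fun i => h (Sum.inl i)
  have anti : ∀ i k l j : Fin (m + 1), i < k → k < l → l < j → i.val + j.val = k.val + l.val →
      (∀ a b : Fin (m + 1), a.val + b.val < i.val + j.val → q a b = 0) →
      q i j = 0 ∨ q k l = 0 := by
    intro i k l j hik hkl hlj hs' hlt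
    have h0 := hdet ![i, k, l, j]
    have e1 : (Matrix.of fun a b => q (![i, k, l, j] a) (![i, k, l, j] b)) =
        !![0, 0, 0, q i j; 0, 0, q k l, q k j; 0, q k l, 0, q l j; q i j, q k j, q l j, 0] := by
      ext a b
      fin_cases a <;> fin_cases b <;> simp [hd]
      all_goals first
        | exact hs _ _
        | exact hlt _ _ (by simp only [Fin.lt_def] at *; omega)
    have e2 : ∀ a b u v : R, (!![0, 0, 0, a; 0, 0, b, u; 0, b, 0, v; a, u, v, 0] :
        Matrix (Fin 4) (Fin 4) R).det = (a * b) ^ 2 := by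
      intro a b u v
      simp [Matrix.det_succ_row_zero, Fin.sum_univ_succ, Fin.succAbove]
      ring
    rw [e1, e2] at h0
    exact mul_eq_zero.1 (pow_eq_zero_iff (two_ne_zero) |>.1 h0)
  have main : ∀ s : ℕ, ∀ i j : Fin (m + 1), i.val + j.val = s → q i j = 0 := by
    intro s
    induction s using Nat.strong_induction_on with
    | _ s ih =>
    have aux : ∀ i j : Fin (m + 1), i < j → i.val + j.val = s → q i j = 0 := by
      intro i j hij hsum
      by_contra hne
      have hl : s - 1 < 2 * m - 1 := by
        have := j.isLt
        have : i.val < j.val := hij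
        omega
      have h0 := h (Sum.inr ⟨s - 1, hl⟩)
      have hs1 : s - 1 + 1 = s := by
        have : i.val < j.val := hij
        omega
      simp only [diagFamily, Sum.elim_inr, hs1] at h0
      rw [Finset.sum_eq_single (i, j)] at h0
      · rw [if_pos ⟨hij, hsum⟩] at h0
        exact hne h0
      · rintro ⟨k, l⟩ - hkl
        split_ifs with hc
        · obtain ⟨hc1, hc2⟩ := hc
          simp only at hc1 hc2
          rcases lt_trichotomy i k with hik | hik | hik
          · refine (anti i k l j hik hc1 ?_ ?_ fun a b hab => ih _ (by omega) a b rfl).resolve_left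
              hne
            all_goals simp only [Fin.lt_def] at *; omega
          · exfalso
            apply hkl
            subst hik
            simp only [Prod.mk.injEq, true_and]
            ext; omega
          · refine (anti k i j l hik hij ?_ ?_ fun a b hab => ih _ (by omega) a b rfl).resolve_right
              hne
            all_goals simp only [Fin.lt_def] at *; omega
        · rfl
      · simp
    intro i j hsum
    rcases lt_trichotomy i j with hij | hij | hij
    · exact aux i j hij hsum
    · subst hij; exact hd i
    · rw [hs]; exact aux j i hij (by omega)
  exact main _ i j rfl

/-- The Gram matrix of the columns of `z` with respect to the ternary form with matrix `G`. -/
def gram {R : Type*} [CommRing R] {m : ℕ} (G : Matrix (Fin 3) (Fin 3) R)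
    (z : Matrix (Fin 3) (Fin (m + 1)) R) (i j : Fin (m + 1)) : R :=
  (z.transpose * G * z) i j

theorem gram_map {R S : Type*} [CommRing R] [CommRing S] {m : ℕ} (φ : R →+* S)
    (G : Matrix (Fin 3) (Fin 3) R) (z : Matrix (Fin 3) (Fin (m + 1)) R) (i j : Fin (m + 1)) :
    φ (gram G z i j) = gram (G.map φ) (z.map φ) i j := by
  simp [gram, Matrix.mul_apply, map_sum]

theorem gram_symm {R : Type*} [CommRing R] {m : ℕ} (G : Matrix (Fin 3) (Fin 3) R)
    (hG : G.IsSymm) (z : Matrix (Fin 3) (Fin (m + 1)) R) (i j : Fin (m + 1)) :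
    gram G z i j = gram G z j i := by
  have : (z.transpose * G * z).transpose = z.transpose * G * z := by
    simp [Matrix.transpose_mul, hG.eq, Matrix.mul_assoc]
  exact congrFun (congrFun this j) i

theorem gram_det_eq_zero {R : Type*} [CommRing R] {m : ℕ} (G : Matrix (Fin 3) (Fin 3) R)
    (z : Matrix (Fin 3) (Fin (m + 1)) R) (e : Fin 4 → Fin (m + 1)) :
    (Matrix.of fun a b => gram G z (e a) (e b)).det = 0 :=
  Matrix.det_mul_eq_zero_of_succ ((z.transpose * G).submatrix e id) (z.submatrix id e)

theorem gram_eq_zero_of_diagFamily_eq_zero {R : Type*} [CommRing R] [IsDomain R] {m : ℕ}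
    (G : Matrix (Fin 3) (Fin 3) R) (hG : G.IsSymm) (z : Matrix (Fin 3) (Fin (m + 1)) R)
    (h : ∀ i, diagFamily (gram G z) i = 0) (i j : Fin (m + 1)) : gram G z i j = 0 :=
  eq_zero_of_diagFamily_eq_zero _ (gram_symm G hG z) (gram_det_eq_zero G z) h i j

theorem pderiv_comm {R σ : Type*} [CommRing R] (i j : σ) (p : MvPolynomial σ R) :
    pderiv i (pderiv j p) = pderiv j (pderiv i p) := by
  classical
  have h : ⁅pderiv (R := R) i, pderiv (R := R) j⁆ = 0 := by
    refine derivation_ext fun l => ?_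
    rw [Derivation.commutator_apply, pderiv_X, pderiv_X]
    simp only [Pi.single_apply]
    split_ifs <;> simp
  have := congrArg (fun D => D p) h
  simpa [Derivation.commutator_apply, sub_eq_zero] using this

theorem exists_gram_matrix_of_isSmoothHypersurface {k : Type*} [Field k] (hk2 : (2 : k) ≠ 0)
    (F : MvPolynomial (Fin 3) k) (hF : F.IsHomogeneous 2) (hsm : IsSmoothHypersurface F) :
    ∃ G : Matrix (Fin 3) (Fin 3) k, G.IsSymm ∧ G.det ≠ 0 ∧
      2 * F = ∑ a, ∑ b, X a * C (G a b) * X b := by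
  let G : Matrix (Fin 3) (Fin 3) k := Matrix.of fun a b => coeff 0 (pderiv b (pderiv a F))
  have h2 : ∀ a b, pderiv b (pderiv a F) = C (G a b) := by
    intro a b
    have : (pderiv b (pderiv a F)).IsHomogeneous 0 := (hF.pderiv (i := a)).pderiv (i := b)
    exact totalDegree_eq_zero_iff_eq_C.1 (Nat.le_zero.1 this.totalDegree_le)
  have h1 : ∀ a, pderiv a F = ∑ b, C (G a b) * X b := by
    intro a
    have h : (pderiv a F).IsHomogeneous 1 := hF.pderiv (i := a)
    have := h.sum_X_mul_pderiv
    rw [one_smul] at this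
    rw [← this]
    exact Finset.sum_congr rfl fun b _ => by rw [h2, mul_comm]
  have h0 : 2 * F = ∑ a, ∑ b, X a * C (G a b) * X b := by
    have := hF.sum_X_mul_pderiv
    rw [two_nsmul, ← two_mul] at this
    rw [← this]
    refine Finset.sum_congr rfl fun a _ => ?_
    rw [h1, Finset.mul_sum]
    exact Finset.sum_congr rfl fun b _ => by rw [mul_assoc]
  refine ⟨G, ?_, ?_, h0⟩
  · ext a b
    simp only [Matrix.transpose_apply, G, Matrix.of_apply]
    rw [pderiv_comm]
  · intro hdet
    have hdet' : (G.map (algebraMap k (AlgebraicClosure k))).det = 0 := by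
      rw [← RingHom.mapMatrix_apply, ← RingHom.map_det, hdet, map_zero]
    obtain ⟨v, hv, hGv⟩ := Matrix.exists_mulVec_eq_zero_iff.2 hdet'
    have hd : ∀ i, eval v ((pderiv i F).map (algebraMap k (AlgebraicClosure k))) = 0 := by
      intro a
      rw [h1]
      have := congrFun hGv a
      simpa [Matrix.mulVec, dotProduct, map_sum] using this
    refine hsm v hv ⟨?_, hd⟩
    have h3 := congrArg (fun p => eval v (p.map (algebraMap k (AlgebraicClosure k))))
      hF.sum_X_mul_pderiv
    simp only [map_sum, map_mul, map_X, eval_X, hd, mul_zero, Finset.sum_const_zero,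
      two_nsmul, ← two_mul] at h3
    have h2' : (2 : AlgebraicClosure k) ≠ 0 := by
      have := (map_ne_zero (algebraMap k (AlgebraicClosure k))).2 hk2
      rwa [map_ofNat] at this
    rw [map_ofNat, map_ofNat] at h3
    exact (mul_eq_zero.1 h3.symm).resolve_left h2'

theorem gram_vecMulVec {R : Type*} [CommRing R] {m : ℕ} (G : Matrix (Fin 3) (Fin 3) R)
    (x : Fin 3 → R) (y : Fin (m + 1) → R) (i j : Fin (m + 1)) :
    gram G (Matrix.vecMulVec x y) i j = (∑ a, ∑ b, x a * G a b * x b) * (y i * y j) := by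
  simp only [gram, Matrix.mul_apply, Matrix.transpose_apply, Matrix.vecMulVec_apply,
    Finset.sum_mul]
  rw [Finset.sum_comm]
  exact Finset.sum_congr rfl fun a _ => Finset.sum_congr rfl fun b _ => by ring

theorem exists_eq_vecMulVec_of_gram_eq_zero {K : Type*} [Field K] {m : ℕ}
    (G : Matrix (Fin 3) (Fin 3) K) (hG : G.det ≠ 0)
    (z : Matrix (Fin 3) (Fin (m + 1)) K) (h : ∀ i j, gram G z i j = 0) :
    ∃ x y, z = Matrix.vecMulVec x y ∧ ∑ a, ∑ b, x a * G a b * x b = 0 := by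
  have hz : z.transpose * (G * z) = 0 := by
    rw [← Matrix.mul_assoc]; ext i j; exact h i j
  have hr := Matrix.rank_add_rank_le_card_of_mul_eq_zero hz
  rw [Matrix.rank_transpose, Matrix.rank_mul_eq_right_of_isUnit_det _ _ (isUnit_iff_ne_zero.2 hG)]
    at hr
  have hr1 : Module.finrank K (LinearMap.range z.mulVecLin) ≤ 1 := by
    have : z.rank ≤ 1 := by simp at hr; omega
    exact this
  obtain ⟨⟨v, hv⟩, hspan⟩ := finrank_le_one_iff.1 hr1
  have hcol : ∀ j, ∃ c : K, ∀ i, z i j = v i * c := by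
    intro j
    obtain ⟨c, hc⟩ := hspan ⟨z.mulVecLin (Pi.single j 1), LinearMap.mem_range_self _ _⟩
    refine ⟨c, fun i => ?_⟩
    have := congrFun (congrArg Subtype.val hc) i
    simp at this
    rw [← this, mul_comm]
  choose y hy using hcol
  have hzy : z = Matrix.vecMulVec v y := by ext i j; exact hy j i
  by_cases hy0 : y = 0
  · exact ⟨0, 0, by rw [hzy, hy0]; ext; simp [Matrix.vecMulVec_apply], by simp⟩
  · obtain ⟨j, hj⟩ := Function.ne_iff.1 hy0
    refine ⟨v, y, hzy, ?_⟩
    have := h j j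
    rw [hzy, gram_vecMulVec] at this
    exact (mul_eq_zero.1 this).resolve_right (mul_ne_zero hj hj)

/-- The matrix of variables of the coordinate ring of `ℙ^{3m+2}`. -/
noncomputable def varMatrix (R : Type*) [CommRing R] (m : ℕ) :
    Matrix (Fin 3) (Fin (m + 1)) (MvPolynomial (Fin 3 × Fin (m + 1)) R) :=
  Matrix.of fun i j => X (i, j)

/-- The `3m` quadratic forms cutting out `C × ℙᵐ` set-theoretically. -/
noncomputable def conicFamily {R : Type*} [CommRing R] (m : ℕ) (G : Matrix (Fin 3) (Fin 3) R) :
    Fin (m + 1) ⊕ Fin (2 * m - 1) → MvPolynomial (Fin 3 × Fin (m + 1)) R :=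
  diagFamily (gram (G.map C) (varMatrix R m))

theorem conicFamily_mem_segreIdeal {k : Type*} [Field k] (m : ℕ) (F : MvPolynomial (Fin 3) k)
    (G : Matrix (Fin 3) (Fin 3) k) (hFG : 2 * F = ∑ a, ∑ b, X a * C (G a b) * X b)
    (i : Fin (m + 1) ⊕ Fin (2 * m - 1)) :
    conicFamily m G i ∈ segreIdeal k 2 m (Ideal.span {F}) ⊥ := by
  refine diagFamily_mem _ _ (fun a b => ?_) i
  rw [segreIdeal, RingHom.mem_ker]
  set J := (Ideal.span {F}).map (rename (R := k) (Sum.inl : Fin 3 → Fin 3 ⊕ Fin (m + 1))) ⊔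
    (⊥ : Ideal (MvPolynomial (Fin (m + 1)) k)).map
      (rename (R := k) (Sum.inr : Fin (m + 1) → Fin 3 ⊕ Fin (m + 1))) with hJ
  set ψ := aeval (R := k) fun p : Fin (2 + 1) × Fin (m + 1) =>
    Ideal.Quotient.mk J (X (Sum.inl p.1) * X (Sum.inr p.2)) with hψ
  let x : Fin 3 → MvPolynomial (Fin 3 ⊕ Fin (m + 1)) k ⧸ J :=
    fun a => Ideal.Quotient.mk J (X (Sum.inl a))
  let y : Fin (m + 1) → MvPolynomial (Fin 3 ⊕ Fin (m + 1)) k ⧸ J :=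
    fun a => Ideal.Quotient.mk J (X (Sum.inr a))
  let Ψ : MvPolynomial (Fin 3 × Fin (m + 1)) k →+* (MvPolynomial (Fin 3 ⊕ Fin (m + 1)) k ⧸ J) :=
    ψ.toRingHom
  have e1 : (varMatrix k m).map Ψ = Matrix.vecMulVec x y := by
    ext a b
    simp [varMatrix, Matrix.vecMulVec_apply, x, y, hψ, Ψ]
  have e2 : Ψ (gram (G.map C) (varMatrix k m) a b) =
      gram ((G.map C).map Ψ) ((varMatrix k m).map Ψ) a b :=
    gram_map Ψ _ _ a b
  have e3 : ∑ a, ∑ b, x a * (G.map C).map Ψ a b * x b =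
      Ideal.Quotient.mk J (rename Sum.inl (2 * F)) := by
    rw [hFG]
    simp only [map_sum, map_mul, rename_X, rename_C, Matrix.map_apply]
    refine Finset.sum_congr rfl fun a _ => Finset.sum_congr rfl fun b _ => ?_
    congr 2
    simp [hψ, Ψ]
    rfl
  have e4 : Ideal.Quotient.mk J (rename Sum.inl (2 * F)) = 0 := by
    rw [Ideal.Quotient.eq_zero_iff_mem, map_mul]
    refine Ideal.mul_mem_left _ _ (Ideal.mem_sup_left (Ideal.mem_map_of_mem _ ?_))
    exact Ideal.mem_span_singleton_self F
  change Ψ (gram (G.map C) (varMatrix k m) a b) = 0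
  rw [e2, e1, gram_vecMulVec, e3, e4, zero_mul]

theorem segreIdeal_le_of_conicFamily_mem {k : Type*} [Field k] (hk2 : (2 : k) ≠ 0) (m : ℕ)
    (F : MvPolynomial (Fin 3) k) (G : Matrix (Fin 3) (Fin 3) k) (hs : G.IsSymm) (hG : G.det ≠ 0)
    (hFG : 2 * F = ∑ a, ∑ b, X a * C (G a b) * X b)
    (P : Ideal (MvPolynomial (Fin 3 × Fin (m + 1)) k)) [P.IsPrime]
    (hP : ∀ i, conicFamily m G i ∈ P) :
    segreIdeal k 2 m (Ideal.span {F}) ⊥ ≤ P := by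
  let Ω := FractionRing (MvPolynomial (Fin 3 × Fin (m + 1)) k ⧸ P)
  let φ : MvPolynomial (Fin 3 × Fin (m + 1)) k →ₐ[k] Ω :=
    (IsScalarTower.toAlgHom k (MvPolynomial (Fin 3 × Fin (m + 1)) k ⧸ P) Ω).comp
      (Ideal.Quotient.mkₐ k P)
  have hφ : ∀ f, φ f = 0 ↔ f ∈ P := by
    intro f
    rw [← Ideal.Quotient.eq_zero_iff_mem]
    exact (FaithfulSMul.algebraMap_eq_zero_iff (MvPolynomial (Fin 3 × Fin (m + 1)) k ⧸ P) Ω)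
  let z := (varMatrix k m).map φ
  have hGφ : (G.map C).map φ = G.map (algebraMap k Ω) := by
    ext a b
    simp only [Matrix.map_apply]
    exact φ.commutes (G a b)
  have hgram : ∀ i j, gram (G.map (algebraMap k Ω)) z i j = 0 := by
    refine gram_eq_zero_of_diagFamily_eq_zero _ (hs.map _) _ fun i => ?_
    have h1 : φ (conicFamily m G i) = 0 := (hφ _).2 (hP i)
    have h2 := diagFamily_map (φ : _ →+* Ω) (gram (G.map C) (varMatrix k m)) i
    have h3 : (fun a b => (φ : _ →+* Ω) (gram (G.map C) (varMatrix k m) a b)) =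
        gram (G.map (algebraMap k Ω)) z := by
      funext a b
      rw [gram_map, ← hGφ]
      rfl
    rw [h3] at h2
    rw [← h2]
    exact h1
  have hdet : (G.map (algebraMap k Ω)).det ≠ 0 := by
    rw [← RingHom.mapMatrix_apply, ← RingHom.map_det]
    exact (map_ne_zero _).2 hG
  obtain ⟨x, y, hz, hx⟩ := exists_eq_vecMulVec_of_gram_eq_zero _ hdet z hgram
  let ψ : MvPolynomial (Fin 3 ⊕ Fin (m + 1)) k →ₐ[k] Ω := aeval (Sum.elim x y)
  have hF : ψ (rename Sum.inl F) = 0 := by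
    have h1 : ψ (rename Sum.inl (2 * F)) = 0 := by
      rw [hFG, ← hx]
      simp [map_sum, ψ]
    rw [map_mul, map_mul, map_ofNat, map_ofNat] at h1
    refine (mul_eq_zero.1 h1).resolve_left ?_
    have := (map_ne_zero (algebraMap k Ω)).2 hk2
    rwa [map_ofNat] at this
  set J := (Ideal.span {F}).map (rename (R := k) (Sum.inl : Fin 3 → Fin 3 ⊕ Fin (m + 1))) ⊔
    (⊥ : Ideal (MvPolynomial (Fin (m + 1)) k)).map
      (rename (R := k) (Sum.inr : Fin (m + 1) → Fin 3 ⊕ Fin (m + 1))) with hJ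
  have hJψ : ∀ f ∈ J, ψ f = 0 := by
    have : J ≤ RingHom.ker ψ := by
      rw [hJ, Ideal.map_bot, sup_bot_eq, Ideal.map_span, Ideal.span_le]
      rintro _ ⟨f, hf, rfl⟩
      rw [Set.mem_singleton_iff.1 hf]
      exact hF
    exact this
  let ψ' : (MvPolynomial (Fin 3 ⊕ Fin (m + 1)) k ⧸ J) →ₐ[k] Ω := Ideal.Quotient.liftₐ J ψ hJψ
  have hcomp : ψ'.comp (aeval (R := k) fun p : Fin (2 + 1) × Fin (m + 1) =>
      Ideal.Quotient.mk J (X (Sum.inl p.1) * X (Sum.inr p.2))) = φ := by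
    refine MvPolynomial.algHom_ext fun p => ?_
    have h1 : φ (X p) = x p.1 * y p.2 := congrFun (congrFun hz p.1) p.2
    rw [h1]
    simp only [AlgHom.comp_apply, aeval_X]
    change ψ (X (Sum.inl p.1) * X (Sum.inr p.2)) = _
    simp [ψ]
  intro f hf
  rw [← hφ, ← hcomp, AlgHom.comp_apply]
  rw [segreIdeal, RingHom.mem_ker] at hf
  have h0 : ψ' 0 = 0 := map_zero ψ'
  rw [← h0]
  exact congrArg ψ' hf

theorem radical_span_conicFamily {k : Type*} [Field k] (hk2 : (2 : k) ≠ 0) (m : ℕ)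
    (F : MvPolynomial (Fin 3) k) (G : Matrix (Fin 3) (Fin 3) k) (hs : G.IsSymm) (hG : G.det ≠ 0)
    (hFG : 2 * F = ∑ a, ∑ b, X a * C (G a b) * X b) :
    (Ideal.span (Set.range (conicFamily m G))).radical =
      (segreIdeal k 2 m (Ideal.span {F}) ⊥).radical := by
  apply le_antisymm
  · refine Ideal.radical_mono (Ideal.span_le.2 ?_)
    rintro _ ⟨i, rfl⟩
    exact conicFamily_mem_segreIdeal m F G hFG i
  · rw [Ideal.radical_le_radical_iff, Ideal.radical_eq_sInf]
    refine le_sInf fun P hP => ?_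
    have := hP.2
    exact segreIdeal_le_of_conicFamily_mem hk2 m F G hs hG hFG P fun i =>
      hP.1 (Ideal.subset_span ⟨i, rfl⟩)

theorem conicFamily_isHomogeneous {k : Type*} [CommRing k] (m : ℕ)
    (G : Matrix (Fin 3) (Fin 3) k) (i : Fin (m + 1) ⊕ Fin (2 * m - 1)) :
    (conicFamily m G i).IsHomogeneous 2 := by
  have hg : ∀ a b, (gram (G.map C) (varMatrix k m) a b).IsHomogeneous 2 := by
    intro a b
    simp only [gram, Matrix.mul_apply, Finset.sum_mul]
    refine IsHomogeneous.sum _ _ _ fun i _ => IsHomogeneous.sum _ _ _ fun j _ => ?_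
    exact ((isHomogeneous_X k _).mul (isHomogeneous_C _ _)).mul (isHomogeneous_X k _)
  cases i with
  | inl i => exact hg i i
  | inr l =>
    refine IsHomogeneous.sum _ _ _ fun p _ => ?_
    split_ifs
    exacts [hg _ _, isHomogeneous_zero _ _ _]

theorem pderiv_aeval_linear {R σ : Type*} [CommRing R] [Fintype σ] [DecidableEq σ]
    (A : σ → σ → R) (j : σ) (f : MvPolynomial σ R) :
    pderiv j (aeval (fun i => ∑ l, C (A i l) * X l : σ → MvPolynomial σ R) f) =
      ∑ i, C (A i j) * aeval (fun i => ∑ l, C (A i l) * X l) (pderiv i f) := by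
  induction f using MvPolynomial.induction_on with
  | C a => simp [algebraMap_eq]
  | add f g hf hg => simp only [map_add, hf, hg, mul_add, Finset.sum_add_distrib]
  | mul_X f n hf =>
    have h1 : pderiv j (∑ l, C (A n l) * X l : MvPolynomial σ R) = C (A n j) := by
      simp [map_sum, pderiv_X, Pi.single_apply]
    have h2 : ∀ i, pderiv i (X n : MvPolynomial σ R) = if i = n then 1 else 0 := by
      intro i
      rw [pderiv_X, Pi.single_apply]
      simp [eq_comm]
    simp only [map_mul, aeval_X, pderiv_mul, h1, hf, h2, map_add, mul_add,
      Finset.sum_add_distrib]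
    congr 1
    · rw [Finset.sum_mul]
      exact Finset.sum_congr rfl fun i _ => by ring
    · simp [apply_ite, mul_comm]

/-- Cayley's Omega operator on polynomials in the entries of a `2 × 2` matrix. -/
noncomputable def cayleyOmega {L : Type*} [Field L] (f : MvPolynomial (Fin 4) L) :
    MvPolynomial (Fin 4) L :=
  pderiv 0 (pderiv 3 f) - pderiv 1 (pderiv 2 f)

/-- Right translation of polynomials in the entries of a `2 × 2` matrix by `(p, q; r, t)`. -/
noncomputable def rightTranslate {L : Type*} [Field L] (p q r t : L) :
    MvPolynomial (Fin 4) L →ₐ[L] MvPolynomial (Fin 4) L :=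
  aeval fun i => ∑ l, C ((!![p, r, 0, 0; q, t, 0, 0; 0, 0, p, r; 0, 0, q, t] :
    Matrix (Fin 4) (Fin 4) L) i l) * X l

theorem cayleyOmega_rightTranslate {L : Type*} [Field L] (p q r t : L) (h : p * t - q * r = 1)
    (f : MvPolynomial (Fin 4) L) :
    cayleyOmega (rightTranslate p q r t f) = rightTranslate p q r t (cayleyOmega f) := by
  have key := fun (j : Fin 4) (f : MvPolynomial (Fin 4) L) => pderiv_aeval_linear
    (!![p, r, 0, 0; q, t, 0, 0; 0, 0, p, r; 0, 0, q, t] : Matrix (Fin 4) (Fin 4) L) j f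
  change ∀ j f, pderiv j (rightTranslate p q r t f) =
    ∑ i, C _ * rightTranslate p q r t (pderiv i f) at key
  have h' : (C p * C t - C q * C r : MvPolynomial (Fin 4) L) = 1 := by
    rw [← C_mul, ← C_mul, ← C_sub, h, C_1]
  simp only [cayleyOmega, key, pderiv_mul, pderiv_C, Fin.sum_univ_four, map_sub, map_add]
  simp only [Matrix.of_apply, Matrix.cons_val', Matrix.cons_val_zero, Matrix.cons_val_one,
    Matrix.cons_val, Matrix.cons_val_fin_one, C_0, zero_mul, add_zero, zero_add]
  linear_combination (rightTranslate p q r t (pderiv 0 (pderiv 3 f)) -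
    rightTranslate p q r t (pderiv 1 (pderiv 2 f))) * h'

/-- The value of `reynolds` on a monomial. -/
noncomputable def reynoldsWeight (L : Type*) [Field L] (e : Fin 4 →₀ ℕ) : L :=
  if e 0 = e 3 ∧ e 1 = e 2 then
    (-1) ^ e 1 * (e 1).factorial * (e 0).factorial / (e 0 + e 1 + 1).factorial else 0

/-- The Reynolds functional of `SL₂`, acting on polynomials in the entries of a `2 × 2` matrix. -/
noncomputable def reynolds (L : Type*) [Field L] : MvPolynomial (Fin 4) L →ₗ[L] L :=
  (basisMonomials (Fin 4) L).constr L (reynoldsWeight L)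

theorem reynolds_monomial {L : Type*} [Field L] (e : Fin 4 →₀ ℕ) (c : L) :
    reynolds L (monomial e c) = c * reynoldsWeight L e := by
  have h : monomial e c = c • basisMonomials (Fin 4) L e := by
    simp [coe_basisMonomials, smul_monomial]
  rw [h, map_smul, reynolds, Module.Basis.constr_basis, smul_eq_mul]

theorem reynolds_eq_sum {L : Type*} [Field L] (f : MvPolynomial (Fin 4) L) :
    reynolds L f = ∑ e ∈ f.support, coeff e f * reynoldsWeight L e := by
  conv_lhs => rw [f.as_sum]
  rw [map_sum]
  exact Finset.sum_congr rfl fun e _ => reynolds_monomial e _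

theorem reynolds_map {K L : Type*} [Field K] [Field L] (φ : K →+* L)
    (f : MvPolynomial (Fin 4) K) : reynolds L (f.map φ) = φ (reynolds K f) := by
  induction f using MvPolynomial.induction_on' with
  | monomial e c =>
    rw [map_monomial, reynolds_monomial, reynolds_monomial, map_mul]
    congr 1
    simp [reynoldsWeight, apply_ite φ]
  | add f g hf hg => simp only [map_add, hf, hg]

theorem reynolds_C {L : Type*} [Field L] (c : L) : reynolds L (C c) = c := by
  rw [C_apply, reynolds_monomial]
  simp [reynoldsWeight]

theorem reynolds_det_mul {L : Type*} [Field L] [CharZero L] (f : MvPolynomial (Fin 4) L) :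
    reynolds L ((X 0 * X 3 - X 1 * X 2) * f) = reynolds L f := by
  induction f using MvPolynomial.induction_on' with
  | monomial e c =>
    have h1 : (X 0 * X 3 - X 1 * X 2) * monomial e c =
        monomial (Finsupp.single 0 1 + Finsupp.single 3 1 + e) c -
          monomial (Finsupp.single (1 : Fin 4) 1 + Finsupp.single 2 1 + e) c := by
      simp [X, monomial_mul, sub_mul]
    rw [h1, map_sub, reynolds_monomial, reynolds_monomial, reynolds_monomial, ← mul_sub]
    congr 1
    simp only [reynoldsWeight, Finsupp.add_apply, Finsupp.single_apply, Fin.isValue]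
    by_cases hc : e 0 = e 3 ∧ e 1 = e 2
    · obtain ⟨h3, h2⟩ := hc
      simp [h3, h2]
      generalize e 2 = i
      generalize e 3 = j
      rw [show 1 + j + i + 1 = (j + i + 1) + 1 by ring,
        show j + (1 + i) + 1 = (j + i + 1) + 1 by ring,
        show 1 + i = i + 1 by ring, show 1 + j = j + 1 by ring, Nat.factorial_succ (j + i + 1),
        Nat.factorial_succ i, Nat.factorial_succ j]
      have h4 : ((j + i + 1).factorial : L) ≠ 0 := by exact_mod_cast Nat.factorial_ne_zero _
      have h5 : ((j : L) + i + 1 + 1) ≠ 0 := by exact_mod_cast Nat.succ_ne_zero (j + i + 1)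
      push_cast
      field_simp
      ring
    · have : ¬ (1 + e 0 = 1 + e 3 ∧ e 1 = e 2) := by omega
      have : ¬ (e 0 = e 3 ∧ 1 + e 1 = 1 + e 2) := by omega
      simp [*]
  | add f g hf hg => simp only [mul_add, map_add, hf, hg]

theorem reynolds_cayleyOmega_monomial {L : Type*} [Field L] [CharZero L] (e : Fin 4 →₀ ℕ) (c : L) :
    4 * reynolds L (cayleyOmega (monomial e c)) =
      ((e 0 + e 1 + e 2 + e 3 : ℕ) : L) * ((e 0 + e 1 + e 2 + e 3 : ℕ) + 2) *
        reynolds L (monomial e c) := by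
  simp only [cayleyOmega, pderiv_monomial, map_sub, reynolds_monomial, reynoldsWeight,
    Finsupp.tsub_apply, Finsupp.single_apply, Fin.isValue]
  by_cases hc : e 0 = e 3 ∧ e 1 = e 2
  · obtain ⟨h3, h2⟩ := hc
    simp only [h3, h2]
    generalize e 2 = i
    generalize e 3 = j
    simp
    rcases i with _ | i <;> rcases j with _ | j
    · simp
    · have h5 : (j : L) + 1 + 1 ≠ 0 := by exact_mod_cast Nat.succ_ne_zero (j + 1)
      have h6 : (j : L) + 1 ≠ 0 := by exact_mod_cast Nat.succ_ne_zero j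
      have h4 : (j.factorial : L) ≠ 0 := by exact_mod_cast Nat.factorial_ne_zero _
      simp [Nat.factorial_succ]
      field_simp
      ring
    · have h5 : (i : L) + 1 + 1 ≠ 0 := by exact_mod_cast Nat.succ_ne_zero (i + 1)
      have h6 : (i : L) + 1 ≠ 0 := by exact_mod_cast Nat.succ_ne_zero i
      have h4 : (i.factorial : L) ≠ 0 := by exact_mod_cast Nat.factorial_ne_zero _
      simp [Nat.factorial_succ]
      field_simp
      ring
    · have h5 : (j : L) + i + 1 + 1 ≠ 0 := by exact_mod_cast Nat.succ_ne_zero (j + i + 1)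
      have h6 : (j : L) + i + 1 + 1 + 1 ≠ 0 := by exact_mod_cast Nat.succ_ne_zero (j + i + 1 + 1)
      have h4 : ((j + i + 1).factorial : L) ≠ 0 := by exact_mod_cast Nat.factorial_ne_zero _
      simp only [Nat.add_sub_cancel]
      rw [show j + (i + 1) + 1 = (j + i + 1) + 1 by ring,
        show j + 1 + i + 1 = (j + i + 1) + 1 by ring,
        show j + 1 + (i + 1) + 1 = (j + i + 1 + 1) + 1 by ring, Nat.factorial_succ (j + i + 1 + 1),
        Nat.factorial_succ (j + i + 1), Nat.factorial_succ i, Nat.factorial_succ j]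
      push_cast
      field_simp
      ring
  · rw [if_neg hc]
    have hA : (e 3 : L) * (e 0 : L) = 0 ∨ ¬ (e 0 - 1 = e 3 - 1 ∧ e 1 = e 2) := by
      rcases Nat.eq_zero_or_pos (e 3) with h | h
      · simp [h]
      rcases Nat.eq_zero_or_pos (e 0) with h' | h'
      · simp [h']
      right; omega
    have hB : (e 2 : L) * (e 1 : L) = 0 ∨ ¬ (e 0 = e 3 ∧ e 1 - 1 = e 2 - 1) := by
      rcases Nat.eq_zero_or_pos (e 2) with h | h
      · simp [h]
      rcases Nat.eq_zero_or_pos (e 1) with h' | h'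
      · simp [h']
      right; omega
    simp [mul_assoc]
    rw [ite_eq_right_iff.2, ite_eq_right_iff.2, sub_zero]
    · intro hh
      rw [← mul_assoc (e 2 : L), hB.resolve_right (not_not.2 hh), zero_mul, mul_zero]
    · intro hh
      rw [← mul_assoc (e 3 : L), hA.resolve_right (not_not.2 hh), zero_mul, mul_zero]

theorem reynolds_cayleyOmega {L : Type*} [Field L] [CharZero L] (n : ℕ)
    (f : MvPolynomial (Fin 4) L) (hf : f.IsHomogeneous n) :
    4 * reynolds L (cayleyOmega f) = n * (n + 2) * reynolds L f := by
  have h : ∀ e ∈ f.support, 4 * reynolds L (cayleyOmega (monomial e (coeff e f))) =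
      n * (n + 2) * reynolds L (monomial e (coeff e f)) := by
    intro e he
    rw [reynolds_cayleyOmega_monomial, ← hf (mem_support_iff.1 he), Finsupp.weight_apply]
    simp [Finsupp.sum_fintype, Fin.sum_univ_four]
  have h2 : cayleyOmega f = ∑ e ∈ f.support, cayleyOmega (monomial e (coeff e f)) := by
    conv_lhs => rw [f.as_sum]
    simp only [cayleyOmega, map_sum, Finset.sum_sub_distrib]
  conv_rhs => rw [f.as_sum]
  rw [h2, map_sum, map_sum, Finset.mul_sum, Finset.mul_sum]
  exact Finset.sum_congr rfl h

theorem isHomogeneous_aeval_linear {R σ : Type*} [CommRing R] [Fintype σ]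
    (A : σ → σ → R) (n : ℕ) (f : MvPolynomial σ R) (hf : f.IsHomogeneous n) :
    (aeval (fun i => ∑ l, C (A i l) * X l : σ → MvPolynomial σ R) f).IsHomogeneous n := by
  have := hf.aeval (fun i => ∑ l, C (A i l) * X l : σ → MvPolynomial σ R) (n := 1)
    fun i => IsHomogeneous.sum _ _ _ fun l _ => isHomogeneous_C_mul_X _ _
  rwa [one_mul] at this

theorem rightTranslate_isHomogeneous {L : Type*} [Field L] (p q r t : L) (n : ℕ)
    (f : MvPolynomial (Fin 4) L) (hf : f.IsHomogeneous n) :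
    (rightTranslate p q r t f).IsHomogeneous n :=
  isHomogeneous_aeval_linear _ n f hf

theorem reynolds_rightTranslate_of_isHomogeneous {L : Type*} [Field L] [CharZero L]
    (p q r t : L) (h : p * t - q * r = 1) (n : ℕ) (f : MvPolynomial (Fin 4) L)
    (hf : f.IsHomogeneous n) : reynolds L (rightTranslate p q r t f) = reynolds L f := by
  induction n using Nat.strong_induction_on generalizing f with
  | _ n ih =>
    rcases Nat.eq_zero_or_pos n with rfl | hn
    · rw [totalDegree_eq_zero_iff_eq_C.1 (Nat.le_zero.1 hf.totalDegree_le), rightTranslate,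
        aeval_C, algebraMap_eq]
    · have h1 := reynolds_cayleyOmega n _ (rightTranslate_isHomogeneous p q r t n f hf)
      have h2 : (cayleyOmega f).IsHomogeneous (n - 1 - 1) :=
        (hf.pderiv.pderiv).sub (hf.pderiv.pderiv)
      rw [cayleyOmega_rightTranslate p q r t h, ih _ (by omega) _ h2,
        reynolds_cayleyOmega n f hf] at h1
      have hn0 : (n : L) ≠ 0 := by exact_mod_cast hn.ne'
      have hn2 : (n : L) + 2 ≠ 0 := by exact_mod_cast (Nat.succ_ne_zero (n + 1))
      exact (mul_left_cancel₀ (mul_ne_zero hn0 hn2) h1).symm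

theorem reynolds_rightTranslate {L : Type*} [Field L] [CharZero L]
    (p q r t : L) (h : p * t - q * r = 1) (f : MvPolynomial (Fin 4) L) :
    reynolds L (rightTranslate p q r t f) = reynolds L f := by
  conv_lhs => rw [← sum_homogeneousComponent f]
  conv_rhs => rw [← sum_homogeneousComponent f]
  simp only [map_sum]
  exact Finset.sum_congr rfl fun n _ => reynolds_rightTranslate_of_isHomogeneous p q r t h n _
    (homogeneousComponent_isHomogeneous n f)

/-- The Gram matrix of twice the determinant form on symmetric `2 × 2` matrices. -/
def detForm (R : Type*) [CommRing R] : Matrix (Fin 3) (Fin 3) R :=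
  !![0, 0, 1; 0, -2, 0; 1, 0, 0]

theorem detForm_isSymm (R : Type*) [CommRing R] : (detForm R).IsSymm := by
  ext i j
  fin_cases i <;> fin_cases j <;> rfl

theorem detForm_map {R S : Type*} [CommRing R] [CommRing S] (φ : R →+* S) :
    (detForm R).map φ = detForm S := by
  ext i j
  fin_cases i <;> fin_cases j <;> simp [detForm]
  rw [map_ofNat]

theorem gram_detForm {R : Type*} [CommRing R] {m : ℕ}
    (z : Matrix (Fin 3) (Fin (m + 1)) R) (i j : Fin (m + 1)) :
    gram (detForm R) z i j = z 0 i * z 2 j + z 2 i * z 0 j - 2 * (z 1 i * z 1 j) := by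
  simp [gram, detForm, Matrix.mul_apply, Fin.sum_univ_three]
  ring

/-- The action of a `2 × 2` matrix on symmetric `2 × 2` matrices. -/
def symSquare {R : Type*} [CommRing R] (a b c d : R) : Matrix (Fin 3) (Fin 3) R :=
  !![a ^ 2, 2 * a * b, b ^ 2; a * c, a * d + b * c, b * d; c ^ 2, 2 * c * d, d ^ 2]

theorem symSquare_mul {R : Type*} [CommRing R] (a b c d p q r t : R) :
    symSquare a b c d * symSquare p q r t =
      symSquare (a * p + b * r) (a * q + b * t) (c * p + d * r) (c * q + d * t) := by
  ext i j
  fin_cases i <;> fin_cases j <;>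
    simp [symSquare, Matrix.mul_apply, Fin.sum_univ_three] <;> ring

theorem symSquare_map {R S : Type*} [CommRing R] [CommRing S] (φ : R →+* S) (a b c d : R) :
    (symSquare a b c d).map φ = symSquare (φ a) (φ b) (φ c) (φ d) := by
  ext i j
  fin_cases i <;> fin_cases j <;> simp [symSquare] <;> rw [map_ofNat]

theorem gram_detForm_symSquare_mul {R : Type*} [CommRing R] {m : ℕ} (a b c d : R)
    (z : Matrix (Fin 3) (Fin (m + 1)) R) (i j : Fin (m + 1)) :
    gram (detForm R) (symSquare a b c d * z) i j =
      (a * d - b * c) ^ 2 * gram (detForm R) z i j := by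
  simp only [gram_detForm, symSquare, Matrix.mul_apply, Fin.sum_univ_three]
  simp
  ring

/-- The generic translate of the point `z`. -/
noncomputable def genericTranslate {R : Type*} [CommRing R] {m : ℕ}
    (z : Matrix (Fin 3) (Fin (m + 1)) R) :
    Matrix (Fin 3) (Fin (m + 1)) (MvPolynomial (Fin 4) R) :=
  symSquare (X 0) (X 1) (X 2) (X 3 : MvPolynomial (Fin 4) R) *
    z.map (C : R → MvPolynomial (Fin 4) R)

theorem genericTranslate_map {R S : Type*} [CommRing R] [CommRing S] {m : ℕ} (φ : R →+* S)
    (z : Matrix (Fin 3) (Fin (m + 1)) R) (i : Fin 3) (j : Fin (m + 1)) :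
    MvPolynomial.map φ (genericTranslate z i j) = genericTranslate (z.map φ) i j := by
  simp only [genericTranslate, Matrix.mul_apply, Fin.sum_univ_three, map_add, map_mul,
    Matrix.map_apply, map_C]
  fin_cases i <;> simp [symSquare]

/-- Substitution of the generic translate of the point `z`. -/
noncomputable def orbitMap {W L : Type*} [CommRing W] [Field L] [Algebra W L] {m : ℕ}
    (z : Matrix (Fin 3) (Fin (m + 1)) L) :
    MvPolynomial (Fin 3 × Fin (m + 1)) W →ₐ[W] MvPolynomial (Fin 4) L :=
  aeval fun p => genericTranslate z p.1 p.2

/-- The mean value of a polynomial on the `SL₂`-orbit of `z`. -/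
noncomputable def orbitMean {W L : Type*} [CommRing W] [Field L] [Algebra W L] {m : ℕ}
    (z : Matrix (Fin 3) (Fin (m + 1)) L) (P : MvPolynomial (Fin 3 × Fin (m + 1)) W) : L :=
  reynolds L (orbitMap z P)

section orbitMean

variable {W L : Type*} [CommRing W] [Field L] [Algebra W L] {m : ℕ}

theorem orbitMap_varMatrix (z : Matrix (Fin 3) (Fin (m + 1)) L) :
    (varMatrix W m).map (orbitMap (W := W) z) = genericTranslate z := by
  ext1 i j
  simp [varMatrix, orbitMap]

theorem orbitMap_conicFamily (z : Matrix (Fin 3) (Fin (m + 1)) L)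
    (i : Fin (m + 1) ⊕ Fin (2 * m - 1)) :
    orbitMap z (conicFamily m (detForm W) i) =
      (X 0 * X 3 - X 1 * X 2) ^ 2 * C (diagFamily (gram (detForm L) z) i) := by
  have h1 := diagFamily_map (orbitMap (W := W) z).toRingHom
    (gram ((detForm W).map C) (varMatrix W m)) i
  have h2 : (fun a b => (orbitMap (W := W) z).toRingHom
      (gram ((detForm W).map C) (varMatrix W m) a b)) = fun a b =>
      (X 0 * X 3 - X 1 * X 2) ^ 2 * C (gram (detForm L) z a b) := by
    funext a b
    rw [gram_map, detForm_map, detForm_map]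
    have h3 : (varMatrix W m).map (orbitMap (W := W) z).toRingHom = genericTranslate z :=
      orbitMap_varMatrix z
    rw [h3, genericTranslate, gram_detForm_symSquare_mul, gram_map, detForm_map]
  rw [h2, diagFamily_mul, ← diagFamily_map] at h1
  exact h1

theorem orbitMean_add (z : Matrix (Fin 3) (Fin (m + 1)) L)
    (P Q : MvPolynomial (Fin 3 × Fin (m + 1)) W) :
    orbitMean z (P + Q) = orbitMean z P + orbitMean z Q := by
  simp [orbitMean]

theorem orbitMean_sum {κ : Type*} (s : Finset κ) (z : Matrix (Fin 3) (Fin (m + 1)) L)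
    (P : κ → MvPolynomial (Fin 3 × Fin (m + 1)) W) :
    orbitMean z (∑ i ∈ s, P i) = ∑ i ∈ s, orbitMean z (P i) := by
  simp [orbitMean]

theorem orbitMean_C_mul (z : Matrix (Fin 3) (Fin (m + 1)) L) (w : W)
    (P : MvPolynomial (Fin 3 × Fin (m + 1)) W) :
    orbitMean z (C w * P) = algebraMap W L w * orbitMean z P := by
  have h : orbitMap z (C w) = C (algebraMap W L w) := by
    simp [orbitMap, IsScalarTower.algebraMap_apply W L (MvPolynomial (Fin 4) L), algebraMap_eq]
  rw [orbitMean, map_mul, h, ← smul_eq_C_mul, map_smul, smul_eq_mul, orbitMean]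

theorem orbitMean_one (z : Matrix (Fin 3) (Fin (m + 1)) L) :
    orbitMean z (1 : MvPolynomial (Fin 3 × Fin (m + 1)) W) = 1 := by
  rw [orbitMean, map_one, ← C_1, reynolds_C]

theorem orbitMean_conicFamily_mul [CharZero L] (z : Matrix (Fin 3) (Fin (m + 1)) L)
    (i : Fin (m + 1) ⊕ Fin (2 * m - 1)) (P : MvPolynomial (Fin 3 × Fin (m + 1)) W) :
    orbitMean z (conicFamily m (detForm W) i * P) =
      diagFamily (gram (detForm L) z) i * orbitMean z P := by
  rw [orbitMean, map_mul, orbitMap_conicFamily, pow_two, mul_assoc, mul_assoc,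
    reynolds_det_mul, reynolds_det_mul, ← smul_eq_C_mul, map_smul, smul_eq_mul, orbitMean]

theorem orbitMean_conicFamily_pow_mul [CharZero L] (z : Matrix (Fin 3) (Fin (m + 1)) L)
    (i : Fin (m + 1) ⊕ Fin (2 * m - 1)) (n : ℕ) (P : MvPolynomial (Fin 3 × Fin (m + 1)) W) :
    orbitMean z (conicFamily m (detForm W) i ^ n * P) =
      diagFamily (gram (detForm L) z) i ^ n * orbitMean z P := by
  induction n with
  | zero => simp
  | succ n ih => rw [pow_succ', pow_succ', mul_assoc, orbitMean_conicFamily_mul, ih, mul_assoc]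

theorem orbitMean_prod_conicFamily_pow [CharZero L] (z : Matrix (Fin 3) (Fin (m + 1)) L)
    (s : Finset (Fin (m + 1) ⊕ Fin (2 * m - 1))) (n : ℕ) :
    orbitMean z (∏ i ∈ s, conicFamily m (detForm W) i ^ n) =
      ∏ i ∈ s, diagFamily (gram (detForm L) z) i ^ n := by
  classical
  induction s using Finset.induction_on with
  | empty => simpa using orbitMean_one (W := W) z
  | insert i s hi ih =>
    rw [Finset.prod_insert hi, Finset.prod_insert hi, orbitMean_conicFamily_pow_mul, ih]

theorem orbitMean_symSquare_mul [CharZero L] (p q r t : L) (h : p * t - q * r = 1)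
    (z : Matrix (Fin 3) (Fin (m + 1)) L) (P : MvPolynomial (Fin 3 × Fin (m + 1)) W) :
    orbitMean (symSquare p q r t * z) P = orbitMean z P := by
  have key : orbitMap (symSquare p q r t * z) P =
      rightTranslate p q r t (orbitMap z P) := by
    have : orbitMap (W := W) (symSquare p q r t * z) =
        ((rightTranslate p q r t).restrictScalars W).comp (orbitMap z) := by
      refine MvPolynomial.algHom_ext fun x => ?_
      let ρ : MvPolynomial (Fin 4) L →+* MvPolynomial (Fin 4) L :=
        (rightTranslate p q r t).toRingHom
      have h1 : (genericTranslate z).map ρ = genericTranslate (symSquare p q r t * z) := by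
        have h2 : (z.map (C : L → MvPolynomial (Fin 4) L)).map ρ = z.map C := by
          ext1 i j
          exact (rightTranslate p q r t).commutes (z i j)
        have h3 : symSquare (ρ (X 0)) (ρ (X 1)) (ρ (X 2)) (ρ (X 3)) =
            symSquare (X 0) (X 1) (X 2) (X 3) * (symSquare p q r t).map C := by
          rw [symSquare_map, symSquare_mul]
          simp [ρ, rightTranslate, Fin.sum_univ_four, mul_comm]
        rw [genericTranslate, Matrix.map_mul, symSquare_map, h2, h3, Matrix.mul_assoc,
          ← Matrix.map_mul, genericTranslate]
      have h4 := congrFun (congrFun h1 x.1) x.2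
      simp only [orbitMap, aeval_X, AlgHom.comp_apply]
      exact h4.symm
    rw [this]
    rfl
  rw [orbitMean, key, reynolds_rightTranslate p q r t h, orbitMean]

theorem orbitMean_map {K : Type*} [Field K] [Algebra W K] (φ : K →ₐ[W] L)
    (z : Matrix (Fin 3) (Fin (m + 1)) K) (P : MvPolynomial (Fin 3 × Fin (m + 1)) W) :
    orbitMean (z.map φ) P = φ (orbitMean z P) := by
  have h := reynolds_map φ.toRingHom (orbitMap z P)
  have h2 : MvPolynomial.map φ.toRingHom (orbitMap z P) = orbitMap (z.map φ) P := by
    have : (mapAlgHom φ).comp (orbitMap (W := W) z) = orbitMap (z.map φ) := by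
      refine MvPolynomial.algHom_ext fun x => ?_
      simp only [orbitMap, aeval_X, AlgHom.comp_apply]
      exact genericTranslate_map φ.toRingHom z x.1 x.2
    rw [← this]
    rfl
  rw [orbitMean, ← h2, h]
  rfl

theorem symSquare_X_isHomogeneous {R : Type*} [CommRing R] (i j : Fin 3) :
    (symSquare (X 0) (X 1) (X 2) (X 3 : MvPolynomial (Fin 4) R) i j).IsHomogeneous 2 := by
  have h : ∀ a b : Fin 4, (X a * X b : MvPolynomial (Fin 4) R).IsHomogeneous 2 := fun a b =>
    (isHomogeneous_X R a).mul (isHomogeneous_X R b)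
  have h2 : ∀ a b : Fin 4, (2 * X a * X b : MvPolynomial (Fin 4) R).IsHomogeneous 2 := fun a b => by
    rw [mul_assoc, two_mul]
    exact (h a b).add (h a b)
  have h3 : ∀ a : Fin 4, (X a ^ 2 : MvPolynomial (Fin 4) R).IsHomogeneous 2 := fun a => by
    rw [pow_two]
    exact h a a
  fin_cases i <;> fin_cases j <;> simp [symSquare, h, h2, h3]
  exact (h _ _).add (h _ _)

/-- Denominators of `reynolds` in degrees at most `B` are cleared by `e`. -/
def ClearsDenominators (W : Type*) [CommRing W] (B : ℕ) (e : W) : Prop :=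
  ∀ i j : ℕ, i + j ≤ B → ((i + j + 1).factorial : W) ∣ e * i.factorial * j.factorial

theorem ClearsDenominators.mul_orbitMean_mem [CharZero L] {B : ℕ} {e : W}
    (he : ClearsDenominators W B e) (V : Subring L) (hW : ∀ w, algebraMap W L w ∈ V)
    (z : Matrix (Fin 3) (Fin (m + 1)) L) (hz : ∀ i j, z i j ∈ V)
    (P : MvPolynomial (Fin 3 × Fin (m + 1)) W) (hP : P.IsHomogeneous B) :
    algebraMap W L e * orbitMean z P ∈ V := by
  have hdeg : (orbitMap z P).IsHomogeneous (2 * B) := by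
    refine hP.aeval _ fun p => ?_
    simp only [genericTranslate, Matrix.mul_apply, Matrix.map_apply]
    refine IsHomogeneous.sum _ _ _ fun i _ => ?_
    refine IsHomogeneous.mul (n := 0) ?_ (isHomogeneous_C _ _)
    exact symSquare_X_isHomogeneous _ _
  have hcoeff : ∀ d, coeff d (orbitMap z P) ∈ V := by
    let ζ : Matrix (Fin 3) (Fin (m + 1)) V := fun i j => ⟨z i j, hz i j⟩
    let w : W →+* V := (algebraMap W L).codRestrict V hW
    let f : MvPolynomial (Fin 3 × Fin (m + 1)) W →+* MvPolynomial (Fin 4) V :=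
      eval₂Hom (C.comp w) fun p => genericTranslate ζ p.1 p.2
    have hf : (MvPolynomial.map V.subtype).comp f = (orbitMap (W := W) z).toRingHom := by
      refine MvPolynomial.ringHom_ext (fun c => ?_) fun p => ?_
      · simp [f, orbitMap, w, IsScalarTower.algebraMap_apply W L (MvPolynomial (Fin 4) L),
          algebraMap_eq]
      · have h3 : ζ.map V.subtype = z := rfl
        simp only [f, orbitMap, RingHom.comp_apply, eval₂Hom_X', AlgHom.toRingHom_eq_coe,
          RingHom.coe_coe, aeval_X]
        rw [genericTranslate_map, h3]
    intro d
    have := congrArg (coeff d) (DFunLike.congr_fun hf P)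
    change coeff d (MvPolynomial.map V.subtype (f P)) = coeff d (orbitMap z P) at this
    rw [← this, coeff_map]
    exact (coeff d (f P)).2
  rw [orbitMean, reynolds_eq_sum, Finset.mul_sum]
  refine V.sum_mem fun d hd => ?_
  rw [mul_left_comm]
  refine V.mul_mem (hcoeff d) ?_
  rw [reynoldsWeight]
  split_ifs with hc
  · have hd' : d 0 + d 1 ≤ B := by
      have := hdeg (mem_support_iff.1 hd)
      rw [Finsupp.weight_apply, Finsupp.sum_fintype _ _ (by simp)] at this
      simp [Fin.sum_univ_four] at this
      omega
    obtain ⟨w, hw⟩ := he _ _ hd'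
    have hf : ((d 0 + d 1 + 1).factorial : L) ≠ 0 := by exact_mod_cast Nat.factorial_ne_zero _
    have hw' := congrArg (algebraMap W L) hw
    simp only [map_mul, map_natCast] at hw'
    have : algebraMap W L e * ((-1) ^ d 1 * (d 1).factorial * (d 0).factorial /
        (d 0 + d 1 + 1).factorial) = (-1) ^ d 1 * algebraMap W L w := by
      field_simp
      linear_combination hw'
    rw [this]
    exact V.mul_mem (V.pow_mem (V.neg_mem V.one_mem) _) (hW w)
  · rw [mul_zero]
    exact V.zero_mem

end orbitMean

section ValuationSubring

variable {L : Type*} [Field L] (V : ValuationSubring L)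

theorem ValuationSubring.div_mem_of_valuation_le {a b : L} (h : V.valuation a ≤ V.valuation b) :
    a / b ∈ V := by
  rw [← V.valuation_le_one_iff, map_div₀]
  exact div_le_one_of_le₀ h zero_le

theorem ValuationSubring.mem_of_add_mem_of_mul_mem {a b : L} (hadd : a + b ∈ V)
    (hmul : a * b ∈ V) : a ∈ V := by
  by_contra ha
  have ha' := (V.mem_or_inv_mem a).resolve_left ha
  have h0 : a ≠ 0 := by
    rintro rfl
    exact ha V.zero_mem
  have hb : b ∈ V := by
    have := V.mul_mem _ _ hmul ha'
    rwa [mul_comm a b, mul_assoc, mul_inv_cancel₀ h0, mul_one] at this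
  exact ha (by simpa using sub_mem hadd hb)

theorem ValuationSubring.mem_of_sq_mem {a : L} (h : a ^ 2 ∈ V) : a ∈ V := by
  have : (a : L) * -a ∈ V := by
    rw [mul_neg, ← pow_two]
    exact V.neg_mem _ h
  exact V.mem_of_add_mem_of_mul_mem (b := -a) (by simp [V.zero_mem]) this

theorem ValuationSubring.mem_of_diagFamily_mem {m : ℕ}
    (q : Fin (m + 1) → Fin (m + 1) → L) (hs : ∀ i j, q i j = q j i)
    (hdet : ∀ e : Fin 4 → Fin (m + 1), (Matrix.of fun a b => q (e a) (e b)).det = 0)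
    (h : ∀ i, diagFamily q i ∈ V) (i j : Fin (m + 1)) : q i j ∈ V := by
  obtain ⟨⟨i₀, j₀⟩, hmax⟩ := Finite.exists_max
    fun p : Fin (m + 1) × Fin (m + 1) => V.valuation (q p.1 p.2)
  set c := q i₀ j₀ with hc
  by_cases hcV : c ∈ V
  · rw [← V.valuation_le_one_iff] at hcV ⊢
    exact (hmax (i, j)).trans hcV
  exfalso
  have hc0 : c ≠ 0 := by
    intro h0
    exact hcV (h0 ▸ V.zero_mem)
  have hc1 : 1 < V.valuation c := by
    rw [← not_le, V.valuation_le_one_iff]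
    exact hcV
  have hmem : ∀ a b, c⁻¹ * q a b ∈ V := fun a b => by
    rw [mul_comm, ← div_eq_mul_inv]
    exact V.div_mem_of_valuation_le (hmax (a, b))
  let q' : Fin (m + 1) → Fin (m + 1) → V := fun a b => ⟨c⁻¹ * q a b, hmem a b⟩
  have hzero : ∀ a b, IsLocalRing.residue V (q' a b) = 0 := by
    refine eq_zero_of_diagFamily_eq_zero (fun a b => IsLocalRing.residue V (q' a b))
      (fun a b => ?_) (fun e => ?_) fun l => ?_
    · simp only [q', hs a b]
    · have h1 : (Matrix.of fun a b => q' (e a) (e b)).det = 0 := by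
        apply Subtype.val_injective
        have h2 := RingHom.map_det V.subtype (Matrix.of fun a b => q' (e a) (e b))
        have h3 : V.subtype.mapMatrix (Matrix.of fun a b => q' (e a) (e b)) =
            c⁻¹ • Matrix.of fun a b => q (e a) (e b) := rfl
        rw [h3, Matrix.det_smul, hdet, mul_zero] at h2
        exact h2
      have h2 := RingHom.map_det (IsLocalRing.residue V) (Matrix.of fun a b => q' (e a) (e b))
      rw [h1, map_zero] at h2
      exact h2.symm
    · rw [← diagFamily_map]
      have h1 : ((diagFamily q' l : V) : L) = c⁻¹ * diagFamily q l := by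
        rw [← diagFamily_mul]
        exact diagFamily_map V.subtype q' l
      rw [IsLocalRing.residue_eq_zero_iff, V.valuation_lt_one_iff, h1, map_mul, map_inv₀]
      refine lt_of_le_of_lt (mul_le_of_le_one_right zero_le ((V.valuation_le_one_iff _).2 (h l))) ?_
      exact inv_lt_one_of_one_lt₀ hc1
  have h1 : q' i₀ j₀ = 1 := Subtype.ext (inv_mul_cancel₀ hc0)
  have := hzero i₀ j₀
  rw [h1, map_one] at this
  exact one_ne_zero this

end ValuationSubring

/-- A nondegenerate binary quadratic form over an algebraically closed field is split. -/
theorem exists_isotropic_basis {L : Type*} [Field L] [IsAlgClosed L] (h2 : (2 : L) ≠ 0)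
    (x y w : L) (h : x * w - y ^ 2 ≠ 0) :
    ∃ a b c d : L, a * d - b * c = 1 ∧ a ^ 2 * x + 2 * a * b * y + b ^ 2 * w = 0 ∧
      c ^ 2 * x + 2 * c * d * y + d ^ 2 * w = 0 := by
  by_cases hx : x = 0
  · subst hx
    have hy : y ≠ 0 := by
      rintro rfl
      simp at h
    refine ⟨1, 0, -w / (2 * y), 1, by ring, by ring, ?_⟩
    field_simp
    ring
  · obtain ⟨δ, hδ⟩ := IsAlgClosed.exists_pow_nat_eq (y ^ 2 - x * w) two_pos
    have hδ0 : δ ≠ 0 := by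
      rintro rfl
      exact h (by linear_combination hδ)
    refine ⟨(δ - y) / (2 * δ * x), x / (2 * δ * x), -y - δ, x, ?_, ?_, ?_⟩
    · field_simp
      ring
    · field_simp
      linear_combination hδ
    · linear_combination x * hδ

section integrality

variable {L : Type*} [Field L] [IsAlgClosed L] (V : ValuationSubring L) {m : ℕ}

theorem exists_torus_mul_mem (z : Matrix (Fin 3) (Fin (m + 1)) L) (h1 : ∀ j, z 1 j ∈ V)
    (h02 : ∀ i j, z 0 i * z 2 j ∈ V) :
    ∃ a d : L, a * d = 1 ∧ ∀ i j, (symSquare a 0 0 d * z) i j ∈ V := by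
  have key : ∀ a d : L, a * d = 1 → (∀ j, a ^ 2 * z 0 j ∈ V) → (∀ j, d ^ 2 * z 2 j ∈ V) →
      ∃ a d : L, a * d = 1 ∧ ∀ i j, (symSquare a 0 0 d * z) i j ∈ V := by
    refine fun a d had h0 h2 => ⟨a, d, had, fun i j => ?_⟩
    simp only [symSquare, Matrix.mul_apply, Fin.sum_univ_three]
    fin_cases i
    · simpa using h0 j
    · simpa [had] using h1 j
    · simpa using h2 j
  by_cases hx : ∀ j, z 0 j = 0
  · obtain ⟨l, hl⟩ := Finite.exists_max fun j => V.valuation (z 2 j)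
    by_cases hz : z 2 l ∈ V
    · refine key 1 1 (mul_one 1) (fun j => by simp [hx, V.zero_mem]) fun j => ?_
      rw [one_pow, one_mul, ← V.valuation_le_one_iff]
      exact (hl j).trans ((V.valuation_le_one_iff _).2 hz)
    · have hz0 : z 2 l ≠ 0 := fun h0 => hz (h0 ▸ V.zero_mem)
      refine key (z 2 l) (z 2 l)⁻¹ (mul_inv_cancel₀ hz0) (fun j => by simp [hx, V.zero_mem])
        fun j => ?_
      have := V.mul_mem _ _ ((V.mem_or_inv_mem _).resolve_left hz)
        (V.div_mem_of_valuation_le (hl j))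
      convert this using 1
      ring
  · push Not at hx
    obtain ⟨l, hl⟩ := Finite.exists_max fun j => V.valuation (z 0 j)
    have hl0 : z 0 l ≠ 0 := by
      obtain ⟨j, hj⟩ := hx
      intro h0
      have := hl j
      rw [h0, map_zero, le_zero_iff, map_eq_zero] at this
      exact hj this
    obtain ⟨d, hd⟩ := IsAlgClosed.exists_pow_nat_eq (z 0 l) two_pos
    have hd0 : d ≠ 0 := by
      rintro rfl
      exact hl0 (by simp [← hd])
    refine key d⁻¹ d (inv_mul_cancel₀ hd0) (fun j => ?_) fun j => ?_
    · rw [inv_pow, hd, mul_comm, ← div_eq_mul_inv]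
      exact V.div_mem_of_valuation_le (hl j)
    · rw [hd]
      exact h02 l j

theorem exists_symSquare_mul_mem_of_mul_mem (z : Matrix (Fin 3) (Fin (m + 1)) L)
    (h : ∃ a b c d : L, a * d - b * c = 1 ∧ (∀ j, (symSquare a b c d * z) 1 j ∈ V) ∧
      ∀ i j, (symSquare a b c d * z) 0 i * (symSquare a b c d * z) 2 j ∈ V) :
    ∃ a b c d : L, a * d - b * c = 1 ∧ ∀ i j, (symSquare a b c d * z) i j ∈ V := by
  obtain ⟨a, b, c, d, hdet, h1, h02⟩ := h
  obtain ⟨s, t, hst, hV⟩ := exists_torus_mul_mem V _ h1 h02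
  rw [← Matrix.mul_assoc, symSquare_mul] at hV
  refine ⟨_, _, _, _, ?_, hV⟩
  linear_combination s * t * hdet + hst

theorem exists_symSquare_mul_mem_of_gram_eq_zero (h2 : (2 : L) ≠ 0)
    (z : Matrix (Fin 3) (Fin (m + 1)) L) (hz : ∀ i j, gram (detForm L) z i j = 0) :
    ∃ a b c d : L, a * d - b * c = 1 ∧ ∀ i j, (symSquare a b c d * z) i j ∈ V := by
  by_cases h0 : ∀ j, z 0 j = 0
  · have h1 : ∀ j, z 1 j = 0 := fun j => by
      have := hz j j
      rw [gram_detForm, h0] at this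
      simpa [h2] using this
    refine exists_symSquare_mul_mem_of_mul_mem V z ⟨1, 0, 0, 1, by ring, fun j => ?_,
      fun i j => ?_⟩ <;>
    simp [symSquare, Matrix.mul_apply, Fin.sum_univ_three, h0, h1, V.zero_mem]
  · push Not at h0
    obtain ⟨k, hk⟩ := h0
    have hkk : z 0 k * z 2 k = z 1 k ^ 2 := by
      have := hz k k
      rw [gram_detForm] at this
      exact mul_left_cancel₀ h2 (by linear_combination this)
    set g := symSquare (-z 1 k) (z 0 k) (-(z 0 k)⁻¹) 0 with hg
    have hdet : -z 1 k * 0 - z 0 k * -(z 0 k)⁻¹ = 1 := by field_simp; ring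
    have hgram : ∀ i j, gram (detForm L) (g * z) i j = 0 := fun i j => by
      rw [hg, gram_detForm_symSquare_mul, hz, mul_zero]
    have e0 : (g * z) 0 k = 0 := by
      simp only [hg, symSquare, Matrix.mul_apply, Fin.sum_univ_three]
      simp
      linear_combination z 0 k * hkk
    have e1 : (g * z) 1 k = 0 := by
      simp only [hg, symSquare, Matrix.mul_apply, Fin.sum_univ_three]
      simp
      field_simp
      ring
    have e2 : (g * z) 2 k = (z 0 k)⁻¹ := by
      simp only [hg, symSquare, Matrix.mul_apply, Fin.sum_univ_three]
      simp
      field_simp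
    have h0 : ∀ j, (g * z) 0 j = 0 := fun j => by
      have := hgram k j
      rw [gram_detForm, e0, e1, e2] at this
      simpa [hk] using this
    have h1 : ∀ j, (g * z) 1 j = 0 := fun j => by
      have := hgram j j
      rw [gram_detForm, h0] at this
      simpa [h2] using this
    exact exists_symSquare_mul_mem_of_mul_mem V z ⟨_, _, _, _, hdet,
      fun j => by rw [← hg, h1]; exact V.zero_mem,
      fun i j => by rw [← hg, h0, zero_mul]; exact V.zero_mem⟩

theorem exists_symSquare_mul_mem (h2 : (2 : L)⁻¹ ∈ V) (h20 : (2 : L) ≠ 0)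
    (z : Matrix (Fin 3) (Fin (m + 1)) L) (hz : ∀ i j, gram (detForm L) z i j ∈ V) :
    ∃ a b c d : L, a * d - b * c = 1 ∧ ∀ i j, (symSquare a b c d * z) i j ∈ V := by
  have h2V : (2 : L) ∈ V := by
    rw [← one_add_one_eq_two]
    exact V.add_mem _ _ V.one_mem V.one_mem
  set q := gram (detForm L) z with hq
  have hsymm : ∀ i j, q i j = q j i := gram_symm _ (detForm_isSymm L) z
  obtain ⟨⟨k, l⟩, hmax⟩ := Finite.exists_max
    fun p : Fin (m + 1) × Fin (m + 1) => V.valuation (q p.1 p.1 + 2 * q p.1 p.2 + q p.2 p.2)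
  set M := q k k + 2 * q k l + q l l with hM
  have hdiv : ∀ i j, q i j / M ∈ V := by
    intro i j
    have e : q i j / M = 2⁻¹ * 2⁻¹ * 2⁻¹ * (2 * 2 * ((q i i + 2 * q i j + q j j) / M) -
        (q i i + 2 * q i i + q i i) / M - (q j j + 2 * q j j + q j j) / M) := by
      field_simp
      ring
    rw [e]
    have hm := fun i j => V.div_mem_of_valuation_le (hmax (i, j))
    exact V.mul_mem _ _ (V.mul_mem _ _ (V.mul_mem _ _ h2 h2) h2)
      (sub_mem (sub_mem (V.mul_mem _ _ (V.mul_mem _ _ h2V h2V) (hm i j)) (hm i i)) (hm j j))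
  by_cases hM0 : M = 0
  · refine exists_symSquare_mul_mem_of_gram_eq_zero V h20 z fun i j => ?_
    have hz0 : ∀ i j, q i i + 2 * q i j + q j j = 0 := fun i j => by
      have := hmax (i, j)
      rwa [hM0, map_zero, le_zero_iff, map_eq_zero] at this
    have h8 : (2 : L) * 2 * 2 ≠ 0 := by simp [h20]
    refine mul_left_cancel₀ h8 ?_
    linear_combination 4 * hz0 i j - hz0 i i - hz0 j j
  · have hMe : M = 2 * ((z 0 k + z 0 l) * (z 2 k + z 2 l) - (z 1 k + z 1 l) ^ 2) := by
      simp only [hM, hq, gram_detForm]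
      ring
    obtain ⟨a, b, c, d, hdet, h0, h1⟩ := exists_isotropic_basis h20 (z 0 k + z 0 l)
      (z 1 k + z 1 l) (z 2 k + z 2 l) (fun h => hM0 (by rw [hMe, h, mul_zero]))
    set g := symSquare a b c d * z with hg
    have hgram : ∀ i j, q i j = g 0 i * g 2 j + g 2 i * g 0 j - 2 * (g 1 i * g 1 j) := by
      intro i j
      rw [← gram_detForm, hg, gram_detForm_symSquare_mul, hdet, one_pow, one_mul]
    have e0 : g 0 k + g 0 l = 0 := by
      simp only [hg, symSquare, Matrix.mul_apply, Fin.sum_univ_three]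
      simp
      linear_combination h0
    have e2 : g 2 k + g 2 l = 0 := by
      simp only [hg, symSquare, Matrix.mul_apply, Fin.sum_univ_three]
      simp
      linear_combination h1
    set s := g 1 k + g 1 l with hs
    have hMs : M = -2 * s ^ 2 := by
      rw [hM, hgram, hgram, hgram]
      linear_combination 2 * (g 2 k + g 2 l) * e0
    have hs0 : s ≠ 0 := by
      intro hs0
      exact hM0 (by rw [hMs, hs0]; ring)
    have hMV : M ∈ V := V.add_mem _ _ (V.add_mem _ _ (hz k k) (V.mul_mem _ _ h2V (hz k l))) (hz l l)
    have hsV : s ∈ V := by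
      refine V.mem_of_sq_mem ?_
      have : s ^ 2 = -(2⁻¹ * M) := by
        rw [hMs]
        field_simp
      rw [this]
      exact V.neg_mem _ (V.mul_mem _ _ h2 hMV)
    have hy : ∀ j, g 1 j ∈ V := by
      intro j
      have : g 1 j = s * (q k j / M + q l j / M) := by
        rw [← add_div, hMs, hgram, hgram]
        field_simp
        linear_combination g 2 j * e0 + g 0 j * e2
      rw [this]
      exact V.mul_mem _ _ hsV (V.add_mem _ _ (hdiv _ _) (hdiv _ _))
    have hxw : ∀ i j, g 0 i * g 2 j + g 0 j * g 2 i ∈ V := by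
      intro i j
      have : g 0 i * g 2 j + g 0 j * g 2 i = q i j + 2 * (g 1 i * g 1 j) := by
        rw [hgram]
        ring
      rw [this]
      exact V.add_mem _ _ (hz i j) (V.mul_mem _ _ h2V (V.mul_mem _ _ (hy i) (hy j)))
    have hd : ∀ i, g 0 i * g 2 i ∈ V := by
      intro i
      have := V.mul_mem _ _ h2 (hxw i i)
      convert this using 1
      field_simp
      ring
    refine exists_symSquare_mul_mem_of_mul_mem V z ⟨a, b, c, d, hdet, hy, fun i j => ?_⟩
    refine V.mem_of_add_mem_of_mul_mem (hxw i j) ?_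
    have := V.mul_mem _ _ (hd i) (hd j)
    convert this using 1
    ring

end integrality

theorem isIntegral_of_forall_valuationSubring {A K : Type*} [CommRing A] [Field K] [Algebra A K]
    (x : K) (h : ∀ V : ValuationSubring K, (∀ a, algebraMap A K a ∈ V) → x ∈ V) :
    IsIntegral A x := by
  have h1 : x ∈ (integralClosure (Subring.closure (Set.range (algebraMap A K))) K).toSubring := by
    rw [← iInf_valuationSubring_superset, Subring.mem_iInf]
    exact fun V => h V.1 fun a => V.2 ⟨a, rfl⟩
  have h2 : IsIntegral (Subring.closure (Set.range (algebraMap A K))) x := h1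
  let φ : A →+* Subring.closure (Set.range (algebraMap A K)) :=
    (algebraMap A K).codRestrict _ fun a => Subring.subset_closure ⟨a, rfl⟩
  let _ := φ.toAlgebra
  have : IsScalarTower A (Subring.closure (Set.range (algebraMap A K))) K :=
    IsScalarTower.of_algebraMap_eq fun _ => rfl
  have : Algebra.IsIntegral A (Subring.closure (Set.range (algebraMap A K))) := by
    refine Algebra.isIntegral_def.2 fun y => RingHom.isIntegral_of_surjective φ (fun y => ?_) y
    obtain ⟨a, ha⟩ : (y : K) ∈ (algebraMap A K).range :=
      (Subring.closure_le (t := (algebraMap A K).range)).2 (fun _ h => h) y.2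
    exact ⟨a, Subtype.ext ha⟩
  exact isIntegral_trans x h2

section integrality

variable {W A K : Type*} [CommRing W] [CommRing A] [Field K] [Algebra W A] [Algebra A K] {m : ℕ}

theorem isIntegral_gram (z : Matrix (Fin 3) (Fin (m + 1)) K)
    (hz : ∀ i, diagFamily (gram (detForm K) z) i ∈ (algebraMap A K).range) (i j : Fin (m + 1)) :
    IsIntegral A (gram (detForm K) z i j) := by
  refine isIntegral_of_forall_valuationSubring _ fun V hV => ?_
  refine V.mem_of_diagFamily_mem _ (gram_symm _ (detForm_isSymm K) z) (gram_det_eq_zero _ z)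
    (fun l => ?_) i j
  obtain ⟨a, ha⟩ := hz l
  exact ha ▸ hV a

variable [CharZero K] [Algebra W K] [IsScalarTower W A K]

theorem isIntegral_mul_orbitMean_of_isAlgClosed [IsAlgClosed K] (h2 : IsUnit (2 : W))
    (z : Matrix (Fin 3) (Fin (m + 1)) K)
    (hz : ∀ i, diagFamily (gram (detForm K) z) i ∈ (algebraMap A K).range)
    {B : ℕ} {e : W} (he : ClearsDenominators W B e) (P : MvPolynomial (Fin 3 × Fin (m + 1)) W)
    (hP : P.IsHomogeneous B) :
    IsIntegral A (algebraMap W K e * orbitMean z P) := by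
  refine isIntegral_of_forall_valuationSubring _ fun V hV => ?_
  have hW : ∀ w, algebraMap W K w ∈ V := fun w => by
    rw [IsScalarTower.algebraMap_apply W A K]
    exact hV _
  have h2V : (2 : K)⁻¹ ∈ V := by
    obtain ⟨u, hu⟩ := h2.exists_right_inv
    have h := congrArg (algebraMap W K) hu
    rw [map_mul, map_one, map_ofNat] at h
    rw [inv_eq_of_mul_eq_one_right h]
    exact hW u
  obtain ⟨a, b, c, d, hdet, hmem⟩ := exists_symSquare_mul_mem V h2V two_ne_zero z fun i j => by
    refine V.mem_of_diagFamily_mem _ (gram_symm _ (detForm_isSymm K) z) (gram_det_eq_zero _ z)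
      (fun l => ?_) i j
    obtain ⟨a, ha⟩ := hz l
    exact ha ▸ hV a
  rw [← orbitMean_symSquare_mul a b c d hdet]
  exact he.mul_orbitMean_mem V.toSubring hW _ hmem P hP

theorem isIntegral_mul_orbitMean (h2 : IsUnit (2 : W)) (z : Matrix (Fin 3) (Fin (m + 1)) K)
    (hz : ∀ i, diagFamily (gram (detForm K) z) i ∈ (algebraMap A K).range)
    {B : ℕ} {e : W} (he : ClearsDenominators W B e) (P : MvPolynomial (Fin 3 × Fin (m + 1)) W)
    (hP : P.IsHomogeneous B) :
    IsIntegral A (algebraMap W K e * orbitMean z P) := by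
  let φ : K →ₐ[W] AlgebraicClosure K := IsScalarTower.toAlgHom W K (AlgebraicClosure K)
  have h := isIntegral_mul_orbitMean_of_isAlgClosed (A := A) h2 (z.map φ) (fun i => ?_) he P hP
  · rw [orbitMean_map, IsScalarTower.algebraMap_apply W K (AlgebraicClosure K)] at h
    rw [← isIntegral_algebraMap_iff (algebraMap K (AlgebraicClosure K)).injective, map_mul]
    exact h
  · obtain ⟨a, ha⟩ := hz i
    refine ⟨a, ?_⟩
    rw [IsScalarTower.algebraMap_apply A K (AlgebraicClosure K), ha, diagFamily_map]
    congr 1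
    funext a b
    rw [gram_map, detForm_map]
    rfl

end integrality

theorem IsAlgebraic.of_quadratic {A K : Type*} [CommRing A] [IsDomain A] [Field K] [Algebra A K]
    (h2 : (2 : K) ≠ 0) {a b c x : K} (ha : IsAlgebraic A a) (hb : IsAlgebraic A b)
    (hc : IsAlgebraic A c) (ha0 : a ≠ 0) (h : a * x ^ 2 + b * x + c = 0) : IsAlgebraic A x := by
  have hn : ∀ n : ℕ, IsAlgebraic A (n : K) := fun n => by
    simpa using isAlgebraic_algebraMap (A := K) (n : A)
  have h4 : IsAlgebraic A ((2 * a * x + b) ^ 2) := by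
    have : (2 * a * x + b) ^ 2 = b ^ 2 - (4 : ℕ) * (a * c) := by
      push_cast
      linear_combination 4 * a * h
    rw [this]
    exact (hb.pow 2).sub ((hn 4).mul (ha.mul hc))
  have h5 : x = (2 * a * x + b - b) * ((2 : ℕ) * a)⁻¹ := by
    push_cast
    field_simp
    ring
  rw [h5]
  exact ((h4.of_pow two_pos).sub hb).mul ((hn 2).mul ha).inv

theorem isAlgebraic_of_isAlgebraic_gram {A K : Type*} [CommRing A] [IsDomain A] [Field K]
    [Algebra A K] (h2 : (2 : K) ≠ 0) {m : ℕ} (z : Matrix (Fin 3) (Fin (m + 1)) K)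
    (hq : ∀ i j, IsAlgebraic A (gram (detForm K) z i j))
    (h00 : z 0 0 = 1) (h10 : z 1 0 = 0) (h01 : z 0 1 = 0) (h11 : z 1 1 ≠ 0)
    (hlead : 4 * z 2 0 * z 1 1 ^ 2 + z 2 1 ^ 2 ≠ 0) (i : Fin 3) (j : Fin (m + 1)) :
    IsAlgebraic A (z i j) := by
  have hn : ∀ n : ℕ, IsAlgebraic A (n : K) := fun n => by
    simpa using isAlgebraic_algebraMap (A := K) (n : A)
  have hn2 : IsAlgebraic A (2 : K) := by exact_mod_cast hn 2
  have hn4 : IsAlgebraic A (4 : K) := by exact_mod_cast hn 4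
  set q := gram (detForm K) z with hqdef
  have e : ∀ i j, q i j = z 0 i * z 2 j + z 2 i * z 0 j - 2 * (z 1 i * z 1 j) :=
    gram_detForm z
  have a20 : IsAlgebraic A (z 2 0) := by
    have : z 2 0 = q 0 0 * 2⁻¹ := by
      rw [e, h00, h10]
      field_simp
      ring
    rw [this]
    exact (hq 0 0).mul hn2.inv
  have a21 : IsAlgebraic A (z 2 1) := by
    have : z 2 1 = q 0 1 := by
      rw [e, h00, h10, h01]
      ring
    rw [this]
    exact hq 0 1
  have a11 : IsAlgebraic A (z 1 1) := by
    refine IsAlgebraic.of_quadratic h2 (b := 0) hn2 (by exact_mod_cast hn 0) (hq 1 1) h2 ?_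
    rw [e, h01]
    ring
  have a0 : ∀ j, IsAlgebraic A (z 0 j) := fun j => by
    refine IsAlgebraic.of_quadratic h2 (a := 4 * z 2 0 * z 1 1 ^ 2 + z 2 1 ^ 2)
      (b := -(4 * z 1 1 ^ 2 * q 0 j + 2 * z 2 1 * q 1 j))
      (c := q 1 j ^ 2 + 2 * z 1 1 ^ 2 * q j j)
      (((hn4.mul a20).mul (a11.pow 2)).add (a21.pow 2))
      (((hn4.mul (a11.pow 2)).mul (hq 0 j)).add ((hn2.mul a21).mul (hq 1 j))).neg
      (((hq 1 j).pow 2).add ((hn2.mul (a11.pow 2)).mul (hq j j))) hlead ?_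
    rw [e 0 j, e 1 j, e j j, h00, h10, h01]
    ring
  have a2 : ∀ j, IsAlgebraic A (z 2 j) := fun j => by
    have : z 2 j = q 0 j - z 2 0 * z 0 j := by
      rw [e, h00, h10]
      ring
    rw [this]
    exact (hq 0 j).sub (a20.mul (a0 j))
  have a1 : ∀ j, IsAlgebraic A (z 1 j) := fun j => by
    have : z 1 j = (z 2 1 * z 0 j - q 1 j) * (2 * z 1 1)⁻¹ := by
      rw [e, h01]
      field_simp
      ring
    rw [this]
    exact ((a21.mul (a0 j)).sub (hq 1 j)).mul (hn2.mul a11).inv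
  fin_cases i
  exacts [a0 j, a1 j, a2 j]

/-- The positions of the free coordinates on the slice. -/
abbrev SliceIndex (m : ℕ) : Type :=
  {p : Fin 3 × Fin (m + 1) // p ∉ ({(0, 0), (1, 0), (0, 1)} : Finset (Fin 3 × Fin (m + 1)))}

theorem card_sliceIndex {m : ℕ} (hm : 1 ≤ m) : Fintype.card (SliceIndex m) = 3 * m := by
  have h01 : (0 : Fin (m + 1)) ≠ 1 := by
    obtain ⟨s, rfl⟩ := Nat.exists_eq_add_of_le' hm
    exact Fin.zero_ne_one
  rw [Fintype.card_subtype_compl, Fintype.card_coe, Fintype.card_prod, Fintype.card_fin,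
    Fintype.card_fin, Finset.card_eq_three.2 ⟨_, _, _, by simp, by simp [h01], by simp, rfl⟩]
  lia

/-- The function field of the slice. -/
abbrev SliceField (W : Type*) [CommRing W] (m : ℕ) : Type _ :=
  FractionRing (MvPolynomial (SliceIndex m) W)

/-- The generic point of the slice, with `(0, 0)`-entry `1` and vanishing `(1, 0)` and `(0, 1)`
entries. -/
noncomputable def slicePoint (W : Type*) [CommRing W] (m : ℕ) :
    Matrix (Fin 3) (Fin (m + 1)) (SliceField W m) := fun i j =>
  if h : (i, j) ∉ ({(0, 0), (1, 0), (0, 1)} : Finset (Fin 3 × Fin (m + 1))) then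
    algebraMap (MvPolynomial (SliceIndex m) W) _ (X ⟨(i, j), h⟩)
  else if (i, j) = (0, 0) then 1 else 0

section slice

theorem slicePoint_apply (W : Type*) [CommRing W] {m : ℕ} (p : SliceIndex m) :
    slicePoint W m p.1.1 p.1.2 = algebraMap (MvPolynomial (SliceIndex m) W) _ (X p) :=
  dif_pos p.2

variable (W : Type*) [CommRing W] [IsDomain W] {m : ℕ}

theorem subfield_eq_top_of_slicePoint_mem (E : Subfield (SliceField W m))
    (hW : ∀ w, algebraMap W (SliceField W m) w ∈ E) (hz : ∀ i j, slicePoint W m i j ∈ E) :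
    E = ⊤ := by
  have h : ∀ p : MvPolynomial (SliceIndex m) W, algebraMap _ (SliceField W m) p ∈ E := fun p => by
    induction p using MvPolynomial.induction_on with
    | C a => exact hW a
    | add p q hp hq =>
      rw [map_add]
      exact E.add_mem hp hq
    | mul_X p i hp =>
      rw [map_mul, ← slicePoint_apply]
      exact E.mul_mem hp (hz _ _)
  rw [eq_top_iff]
  intro x _
  obtain ⟨a, b, -, rfl⟩ := IsFractionRing.div_surjective (A := MvPolynomial (SliceIndex m) W) x
  exact E.div_mem (h a) (h b)

variable [CharZero W]

instance : CharZero (SliceField W m) :=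
  charZero_of_injective_algebraMap
    (FaithfulSMul.algebraMap_injective W (SliceField W m))

theorem isAlgebraic_slicePoint {A : Type*} [CommRing A] [IsDomain A] [Algebra A (SliceField W m)]
    (hm : 1 ≤ m)
    (hz : ∀ i, diagFamily (gram (detForm (SliceField W m)) (slicePoint W m)) i ∈
      (algebraMap A (SliceField W m)).range) (i : Fin 3) (j : Fin (m + 1)) :
    IsAlgebraic A (slicePoint W m i j) := by
  have h01 : (0 : Fin (m + 1)) ≠ 1 := by
    obtain ⟨s, rfl⟩ := Nat.exists_eq_add_of_le' hm
    exact Fin.zero_ne_one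
  have m11 : ((1, 1) : Fin 3 × Fin (m + 1)) ∉ ({(0, 0), (1, 0), (0, 1)} : Finset _) := by
    simp [h01.symm]
  have m20 : ((2, 0) : Fin 3 × Fin (m + 1)) ∉ ({(0, 0), (1, 0), (0, 1)} : Finset _) := by
    simp
  have m21 : ((2, 1) : Fin 3 × Fin (m + 1)) ∉ ({(0, 0), (1, 0), (0, 1)} : Finset _) := by
    simp
  have inj := IsFractionRing.injective (MvPolynomial (SliceIndex m) W) (SliceField W m)
  refine isAlgebraic_of_isAlgebraic_gram two_ne_zero _
    (fun i j => (isIntegral_gram _ hz i j).isAlgebraic) ?_ ?_ ?_ ?_ ?_ i j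
  · simp [slicePoint]
  · simp [slicePoint]
  · simp [slicePoint, h01.symm]
  · rw [slicePoint_apply W ⟨_, m11⟩]
    exact (map_ne_zero_iff _ inj).2 (X_ne_zero _)
  · rw [slicePoint_apply W ⟨_, m11⟩, slicePoint_apply W ⟨_, m20⟩, slicePoint_apply W ⟨_, m21⟩]
    simp only [← map_ofNat (algebraMap (MvPolynomial (SliceIndex m) W) (SliceField W m)), ← map_mul,
      ← map_pow, ← map_add]
    refine (map_ne_zero_iff _ inj).2 fun h => ?_
    have := congrArg (eval (fun p => if p = ⟨(2, 1), m21⟩ then (1 : W) else 0)) h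
    simp at this

theorem algebraicIndependent_sliceFamily (hm : 1 ≤ m) :
    AlgebraicIndependent W (diagFamily (gram (detForm (SliceField W m)) (slicePoint W m))) := by
  set H := diagFamily (gram (detForm (SliceField W m)) (slicePoint W m))
  have halg : ∀ x : SliceField W m, IsAlgebraic (Algebra.adjoin W (Set.range H)) x := by
    let E : Subfield (SliceField W m) :=
      { (Subalgebra.algebraicClosure (Algebra.adjoin W (Set.range H))
          (SliceField W m)).toSubring with
        inv_mem' := fun _ h => IsAlgebraic.inv h }
    have hE : E = ⊤ := subfield_eq_top_of_slicePoint_mem W E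
      (fun w => isAlgebraic_algebraMap (algebraMap W (Algebra.adjoin W (Set.range H)) w))
      (isAlgebraic_slicePoint W hm fun i => ⟨⟨H i, Algebra.subset_adjoin ⟨i, rfl⟩⟩, rfl⟩)
    intro x
    have hx : x ∈ E := by
      rw [hE]
      exact Subfield.mem_top x
    exact hx
  have : Algebra.IsAlgebraic (Algebra.adjoin W (Set.range H)) (SliceField W m) := ⟨halg⟩
  refine (Algebra.IsAlgebraic.isTranscendenceBasis_of_lift_le_trdeg_of_finite W H ?_).1
  have hX : AlgebraicIndependent W
      (IsScalarTower.toAlgHom W (MvPolynomial (SliceIndex m) W) (SliceField W m) ∘ X) :=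
    (algebraicIndependent_X (SliceIndex m) W).map'
      (IsFractionRing.injective (MvPolynomial (SliceIndex m) W) (SliceField W m))
  have hcard := hX.lift_cardinalMk_le_trdeg
  refine le_trans (Cardinal.lift_le.2 (le_of_eq ?_)) hcard
  rw [Cardinal.mk_fintype, Cardinal.mk_fintype, card_sliceIndex hm]
  simp only [Fintype.card_sum, Fintype.card_fin]
  congr 1
  lia

end slice

attribute [local instance] MvPolynomial.gradedAlgebra in
theorem exists_homogeneousComponent_mul_eq {R σ : Type*} [CommRing R] {p : MvPolynomial σ R} {d : ℕ}
    (hp : p.IsHomogeneous d) (c : MvPolynomial σ R) (M : ℕ) :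
    ∃ b : MvPolynomial σ R, b.IsHomogeneous (M - d) ∧ homogeneousComponent M (p * c) = p * b := by
  have key : ∀ n (φ : MvPolynomial σ R),
      (DirectSum.decompose (homogeneousSubmodule σ R) φ n : MvPolynomial σ R) =
        homogeneousComponent n φ := fun n φ => decomposition.decompose'_apply φ n
  by_cases h : d ≤ M
  · refine ⟨homogeneousComponent (M - d) c, homogeneousComponent_isHomogeneous _ _, ?_⟩
    rw [← key, ← key]
    exact DirectSum.coe_decompose_mul_of_left_mem_of_le (homogeneousSubmodule σ R) hp h
  · refine ⟨0, isHomogeneous_zero _ _ _, ?_⟩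
    rw [mul_zero, ← key]
    exact DirectSum.coe_decompose_mul_of_left_mem_of_not_le (homogeneousSubmodule σ R) hp h

theorem ClearsDenominators.mono {W : Type*} [CommRing W] {B B' : ℕ} {e : W}
    (h : ClearsDenominators W B e) (hB : B' ≤ B) : ClearsDenominators W B' e :=
  fun i j hij => h i j (hij.trans hB)

theorem exists_natCast_mul_mem_span {A K : Type*} [CommRing A] [IsDomain A] [IsIntegrallyClosed A]
    [Field K] [Algebra A K] [Algebra (FractionRing A) K] [IsScalarTower A (FractionRing A) K]
    [FiniteDimensional (FractionRing A) K] {κ : Type*} [Fintype κ] (a : A) (x : κ → A) (y : κ → K)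
    (hy : ∀ i, IsIntegral A (y i)) (h : algebraMap A K a = ∑ i, algebraMap A K (x i) * y i) :
    (Module.finrank (FractionRing A) K : A) * a ∈ Ideal.span (Set.range x) := by
  have htr : ∀ i, ∃ b : A, algebraMap A (FractionRing A) b =
      Algebra.trace (FractionRing A) K (y i) := fun i =>
    IsIntegrallyClosed.isIntegral_iff.1 (Algebra.isIntegral_trace (hy i))
  choose b hb using htr
  have h1 := congrArg (Algebra.trace (FractionRing A) K) h
  rw [IsScalarTower.algebraMap_apply A (FractionRing A) K, Algebra.trace_algebraMap, map_sum] at h1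
  have h2 : ∀ i, Algebra.trace (FractionRing A) K (algebraMap A K (x i) * y i) =
      algebraMap A (FractionRing A) (x i * b i) := fun i => by
    rw [IsScalarTower.algebraMap_apply A (FractionRing A) K, ← Algebra.smul_def, map_smul, ← hb,
      map_mul, smul_eq_mul]
  simp only [h2, ← map_sum] at h1
  rw [nsmul_eq_mul, ← map_natCast (algebraMap A (FractionRing A)), ← map_mul] at h1
  rw [IsFractionRing.injective A (FractionRing A) h1]
  exact Ideal.sum_mem _ fun i _ => Ideal.mul_mem_right _ _ (Ideal.subset_span ⟨i, rfl⟩)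

theorem dvd_of_mul_prod_X_pow_mem {W ι : Type*} [CommRing W] [Fintype ι] (t : ℕ) (ht : 1 ≤ t)
    (v w : W) (h : C w * ∏ i, X i ^ (t - 1) ∈
      Ideal.span (Set.range fun i : Option ι =>
        (i.elim (C v) fun i => X i ^ t : MvPolynomial ι W))) : v ∣ w := by
  classical
  obtain ⟨c, hc⟩ := (Ideal.mem_span_range_iff_exists_fun).1 h
  rw [Fintype.sum_option] at hc
  let d : ι →₀ ℕ := Finsupp.equivFunOnFinite.symm fun _ => t - 1
  have hd : (∏ i, X i ^ (t - 1) : MvPolynomial ι W) = monomial d 1 := by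
    rw [monomial_eq, Finsupp.prod_fintype _ _ (by simp)]
    simp [d]
  have h1 := congrArg (coeff d) hc
  rw [hd, coeff_C_mul, coeff_monomial, if_pos rfl, mul_one, coeff_add, coeff_sum,
    Finset.sum_eq_zero, add_zero] at h1
  · refine ⟨coeff d (c none), ?_⟩
    rw [← h1, ← coeff_C_mul, mul_comm (C v)]
    rfl
  · intro i _
    simp only [Option.elim]
    rw [X_pow_eq_monomial, coeff_mul_monomial', if_neg]
    intro hle
    have := hle i
    simp [d] at this
    lia

theorem exists_dvd_of_prod_conicFamily_pow_eq (W : Type*) [CommRing W] [IsDomain W] [CharZero W]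
    [UniqueFactorizationMonoid W] (h2 : IsUnit (2 : W)) {m : ℕ} (hm : 1 ≤ m) :
    ∃ D : ℕ, D ≠ 0 ∧ ∀ t B : ℕ, ∀ e v : W, 1 ≤ t → 6 * m * t ≤ B → ClearsDenominators W B e →
      ∀ (c : Fin (m + 1) ⊕ Fin (2 * m - 1) → MvPolynomial (Fin 3 × Fin (m + 1)) W)
        (c' : MvPolynomial (Fin 3 × Fin (m + 1)) W),
      ∏ i, conicFamily m (detForm W) i ^ (t - 1) =
        ∑ i, conicFamily m (detForm W) i ^ t * c i + C v * c' → v ∣ D * e := by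
  let ι := Fin (m + 1) ⊕ Fin (2 * m - 1)
  let K := SliceField W m
  let H : ι → K := diagFamily (gram (detForm K) (slicePoint W m))
  have hH : AlgebraicIndependent W H := algebraicIndependent_sliceFamily W hm
  let A := MvPolynomial ι W
  let _ : Algebra A K := (aeval H : A →ₐ[W] K).toAlgebra
  have : IsScalarTower W A K := IsScalarTower.of_algebraMap_eq fun w =>
    ((aeval H : A →ₐ[W] K).commutes w).symm
  have hX : ∀ i, algebraMap A K (X i) = H i := fun i => aeval_X H i
  have : FaithfulSMul A K := (faithfulSMul_iff_algebraMap_injective A K).2 hH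
  let _ : Algebra (FractionRing A) K := FractionRing.liftAlgebra A K
  have : IsScalarTower A (FractionRing A) K := FractionRing.isScalarTower_liftAlgebra A K
  have hrange : ∀ i, H i ∈ (algebraMap A K).range := fun i => ⟨X i, hX i⟩
  have hfin : FiniteDimensional (FractionRing A) K := by
    let S : Set K := Set.range fun p : Fin 3 × Fin (m + 1) => slicePoint W m p.1 p.2
    have : Finite S := Set.finite_range _
    have h1 : FiniteDimensional (FractionRing A) (IntermediateField.adjoin (FractionRing A) S) := by
      refine IntermediateField.finiteDimensional_adjoin ?_
      rintro _ ⟨p, rfl⟩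
      exact ((isAlgebraic_slicePoint W hm hrange p.1 p.2).extendScalars
        (IsFractionRing.injective A (FractionRing A))).isIntegral
    have h2 : IntermediateField.adjoin (FractionRing A) S = ⊤ := by
      have h3 := subfield_eq_top_of_slicePoint_mem W
        (IntermediateField.adjoin (FractionRing A) S).toSubfield (fun w => ?_) fun i j =>
        IntermediateField.subset_adjoin _ _ ⟨(i, j), rfl⟩
      · rw [eq_top_iff]
        intro x _
        have : x ∈ (IntermediateField.adjoin (FractionRing A) S).toSubfield := by
          rw [h3]
          exact Subfield.mem_top x
        exact this
      · rw [IsScalarTower.algebraMap_apply W A K,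
          IsScalarTower.algebraMap_apply A (FractionRing A) K]
        exact (IntermediateField.adjoin (FractionRing A) S).algebraMap_mem _
    rw [h2] at h1
    exact
      (IntermediateField.topEquiv (F := FractionRing A) (E := K)).toLinearEquiv.finiteDimensional
  refine ⟨Module.finrank (FractionRing A) K, Module.finrank_pos.ne', ?_⟩
  intro t B e v ht hB he c c' heq
  set h := conicFamily m (detForm W) with hh
  have hhom : ∀ n i, (h i ^ n).IsHomogeneous (2 * n) := fun n i =>
    (conicFamily_isHomogeneous m (detForm W) i).pow n
  let M := ∑ _i : ι, 2 * (t - 1)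
  have hM : M ≤ B := by
    simp only [M, Finset.sum_const, Finset.card_univ, ι, Fintype.card_sum, Fintype.card_fin,
      smul_eq_mul]
    rw [show m + 1 + (2 * m - 1) = 3 * m by lia]
    refine le_trans ?_ hB
    nlinarith [Nat.sub_le t 1]
  have hprod : (∏ i, h i ^ (t - 1)).IsHomogeneous M :=
    IsHomogeneous.prod _ _ _ fun i _ => hhom (t - 1) i
  choose b hb hbe using fun i => exists_homogeneousComponent_mul_eq (hhom t i) (c i) M
  have heq' : ∏ i, h i ^ (t - 1) = ∑ i, h i ^ t * b i + C v * homogeneousComponent M c' := by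
    have := congrArg (homogeneousComponent M) heq
    rw [homogeneousComponent_eq_self hprod] at this
    rw [this, map_add, map_sum, homogeneousComponent_C_mul]
    simp only [hbe]
  have hmean := congrArg (orbitMean (slicePoint W m)) heq'
  rw [orbitMean_prod_conicFamily_pow, orbitMean_add, orbitMean_sum, orbitMean_C_mul] at hmean
  simp only [hh, orbitMean_conicFamily_pow_mul] at hmean
  have hh_int : ∀ n (P : MvPolynomial (Fin 3 × Fin (m + 1)) W), n ≤ M → P.IsHomogeneous n →
      IsIntegral A (algebraMap W K e * orbitMean (slicePoint W m) P) := fun n P hn hP =>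
    isIntegral_mul_orbitMean h2 _ hrange (he.mono (hn.trans hM)) P hP
  have hmem := exists_natCast_mul_mem_span (K := K) (C e * ∏ i, X i ^ (t - 1) : A)
    (fun i : Option ι => i.elim (C v) fun i => X i ^ t)
    (fun i : Option ι => algebraMap W K e * orbitMean (slicePoint W m)
      (i.elim (homogeneousComponent M c') b)) ?_ ?_
  · refine dvd_of_mul_prod_X_pow_mem (ι := ι) t ht v _ ?_
    rw [C_mul, mul_assoc, map_natCast]
    exact hmem
  · rintro (_ | i)
    · exact hh_int M _ le_rfl (homogeneousComponent_isHomogeneous _ _)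
    · exact hh_int _ _ (Nat.sub_le _ _) (hb i)
  · have hC : ∀ w, algebraMap A K (C w) = algebraMap W K w := fun w =>
      (IsScalarTower.algebraMap_apply W A K w).symm
    rw [Fintype.sum_option]
    simp only [map_mul, map_prod, map_pow, hX, hC, Option.elim]
    rw [hmean, mul_add, Finset.mul_sum, add_comm]
    congr 1
    · ring
    · exact Finset.sum_congr rfl fun i _ => mul_left_comm _ _ _

theorem exists_prod_pow_eq_sum_add {R ι : Type*} [CommRing R] [Fintype ι] [DecidableEq ι]
    (h f : ι → R) (i₀ : ι) (hf₀ : f i₀ = 0) (hf : ∀ i, f i ∈ Ideal.span (Set.range h)) (p : R)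
    (T N : ℕ) (hTN : 1 ≤ T * N)
    (hh : ∀ i, h i ^ T ∈ Ideal.span (Set.range f) ⊔ Ideal.span {p}) :
    ∃ (c : ι → R) (c' : R), ∏ i, h i ^ (2 * (T * N) - 1) =
      ∑ i, h i ^ (2 * (T * N)) * c i + p ^ N * c' := by
  let q := Ideal.Quotient.mk (Ideal.span {p ^ N})
  have hspan : ∀ (g : ι → R) (x : R), x ∈ Ideal.span (Set.range g) →
      q x ∈ Ideal.span (Set.range (q ∘ g)) := fun g x hx => by
    rw [Set.range_comp, ← Ideal.map_span]
    exact Ideal.mem_map_of_mem q hx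
  have hpow : ∀ i, q (h i) ^ (T * N) ∈ Ideal.span (Set.range (q ∘ f)) := fun i => by
    obtain ⟨a, ha, b, hb, hab⟩ := Submodule.mem_sup.1 (hh i)
    obtain ⟨c, rfl⟩ := Ideal.mem_span_singleton.1 hb
    have h1 : q (h i) ^ (T * N) = q ((h i ^ T) ^ N - (p * c) ^ N) := by
      rw [map_sub, mul_pow p, map_mul, Ideal.Quotient.eq_zero_iff_mem.2
        (Ideal.mem_span_singleton_self _), zero_mul, sub_zero, ← pow_mul, map_pow]
    rw [h1]
    refine hspan _ _ ((Ideal.span (Set.range f)).mem_of_dvd (sub_dvd_pow_sub_pow _ _ N) ?_)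
    rw [← hab, add_sub_cancel_right]
    exact ha
  have hmem := prod_pow_mem_span_pow (q ∘ h) (q ∘ f) i₀ (by simp [hf₀])
    (fun i => hspan h _ (hf i)) (T * N) hTN hpow
  obtain ⟨c, hc⟩ := Ideal.mem_span_range_iff_exists_fun.1 hmem
  choose b hb using fun i => Ideal.Quotient.mk_surjective (c i)
  have h0 : q (∏ i, h i ^ (2 * (T * N) - 1) - ∑ i, h i ^ (2 * (T * N)) * b i) = 0 := by
    rw [map_sub, sub_eq_zero, map_prod, map_sum]
    simp only [map_pow, map_mul]
    refine hc.symm.trans (Finset.sum_congr rfl fun i _ => ?_)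
    rw [← hb i, mul_comm]
    rfl
  obtain ⟨c', hc'⟩ := Ideal.mem_span_singleton.1 (Ideal.Quotient.eq_zero_iff_mem.1 h0)
  exact ⟨b, c', by rw [← hc']; ring⟩

theorem not_forall_conicFamily_pow_mem (W : Type*) [CommRing W] [IsDomain W] [CharZero W]
    [UniqueFactorizationMonoid W] (h2 : IsUnit (2 : W)) {m : ℕ} (hm : 1 ≤ m) (p : W)
    (hp : ∀ B D : ℕ, D ≠ 0 → ∃ N, 1 ≤ N ∧ ∃ e : W, ClearsDenominators W (B * N) e ∧
      ¬ p ^ N ∣ D * e)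
    (f : Fin (m + 1) ⊕ Fin (2 * m - 1) → MvPolynomial (Fin 3 × Fin (m + 1)) W)
    (i₀ : Fin (m + 1) ⊕ Fin (2 * m - 1)) (hf₀ : f i₀ = 0)
    (hf : ∀ i, f i ∈ Ideal.span (Set.range (conicFamily m (detForm W)))) (T : ℕ) (hT : 1 ≤ T) :
    ¬ ∀ i, conicFamily m (detForm W) i ^ T ∈ Ideal.span (Set.range f) ⊔ Ideal.span {C p} := by
  intro hh
  obtain ⟨D, hD, hdvd⟩ := exists_dvd_of_prod_conicFamily_pow_eq W h2 hm
  obtain ⟨N, hN, e, he, hne⟩ := hp (12 * m * T) D hD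
  have hTN : 1 ≤ T * N := Nat.mul_pos hT hN
  obtain ⟨c, c', hc⟩ := exists_prod_pow_eq_sum_add _ f i₀ hf₀ hf (C p) T N hTN hh
  rw [← C_pow] at hc
  exact hne (hdvd _ _ e (p ^ N) (by lia) (le_of_eq (by ring)) he c c' hc)

/-- Denominators over a field of characteristic zero are cleared by `1`. -/
theorem ClearsDenominators.one_of_charZero (W : Type*) [Field W] [CharZero W] (B : ℕ) :
    ClearsDenominators W B 1 := fun i j _ =>
  (isUnit_iff_ne_zero.2 (by exact_mod_cast Nat.factorial_ne_zero _)).dvd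

theorem clearsDenominators_pow_log (W : Type*) [CommRing W] (p : ℕ) [Fact p.Prime]
    (hW : ∀ n : ℕ, ¬ p ∣ n → IsUnit (n : W)) (B : ℕ) :
    ClearsDenominators W B ((p : W) ^ (2 * Nat.log p (B + 1))) := by
  intro i j hij
  have hp : p.Prime := Fact.out
  have hc : (i + j).choose i ≠ 0 := (Nat.choose_pos (Nat.le_add_right i j)).ne'
  set n := (i + j + 1) * (i + j).choose i with hn
  have hn0 : n ≠ 0 := mul_ne_zero (by lia) hc
  have hfac : (i + j + 1).factorial = n * i.factorial * j.factorial := by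
    rw [Nat.factorial_succ, ← Nat.add_choose_mul_factorial_mul_factorial, hn, Nat.choose_symm_add]
    simp only [Nat.mul_assoc]
  have ha : n.factorization p ≤ 2 * Nat.log p (B + 1) := by
    rw [hn, Nat.factorization_mul (by lia) hc, Finsupp.add_apply, two_mul]
    refine add_le_add ?_ ?_
    · refine (Nat.le_log_of_pow_le hp.one_lt (Nat.ordProj_le p (by lia))).trans
        (Nat.log_mono_right (by lia))
    · exact Nat.factorization_choose_le_log.trans (Nat.log_mono_right (by lia))
  have hdvd : (n : W) ∣ (p : W) ^ (2 * Nat.log p (B + 1)) := by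
    have h := Nat.ordProj_mul_ordCompl_eq_self n p
    rw [← h, Nat.cast_mul, Nat.cast_pow,
      (hW _ (Nat.not_dvd_ordCompl hp hn0)).mul_right_dvd]
    exact pow_dvd_pow _ ha
  rw [hfac, Nat.cast_mul, Nat.cast_mul]
  exact mul_dvd_mul (mul_dvd_mul hdvd dvd_rfl) dvd_rfl

theorem exists_add_two_mul_log_lt {p : ℕ} (hp : 1 < p) (B d : ℕ) :
    ∃ N, 1 ≤ N ∧ d + 2 * Nat.log p (B * N + 1) < N := by
  have hlt : ∀ s, 4 ≤ s → 3 * s < 2 ^ s := fun s hs => by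
    induction s, hs using Nat.le_induction with
    | base => norm_num
    | succ s hs ih => rw [pow_succ]; lia
  obtain ⟨s, hs⟩ : ∃ s, s = d + 2 * B + 6 := ⟨_, rfl⟩
  have h1 := hlt s (by lia)
  have h2 : 2 ^ s ≤ p ^ s := Nat.pow_le_pow_left hp s
  have h3 : Nat.log p (B * p ^ s + 1) < B + 1 + s := by
    refine Nat.log_lt_of_lt_pow (by lia) ?_
    have h4 : B + 1 < p ^ (B + 1) := Nat.lt_pow_self hp
    rw [pow_add]
    have h5 : 0 < 2 ^ s := by positivity
    nlinarith
  exact ⟨p ^ s, by lia, by lia⟩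

theorem exists_not_pow_dvd_pow_log (W : Type*) [CommRing W] [IsDomain W] [CharZero W] (p : ℕ)
    [Fact p.Prime] (hW : ∀ n : ℕ, ¬ p ∣ n → IsUnit (n : W)) (hp : ¬ IsUnit (p : W))
    (B D : ℕ) (hD : D ≠ 0) : ∃ N, 1 ≤ N ∧ ∃ e : W, ClearsDenominators W (B * N) e ∧
      ¬ (p : W) ^ N ∣ D * e := by
  have hpp : p.Prime := Fact.out
  obtain ⟨d, u, hu, rfl⟩ := Nat.exists_eq_pow_mul_and_not_dvd hD p hpp.ne_one
  obtain ⟨N, hN, hlt⟩ := exists_add_two_mul_log_lt hpp.one_lt B d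
  refine ⟨N, hN, _, clearsDenominators_pow_log W p hW (B * N), fun h => ?_⟩
  rw [Nat.cast_mul, Nat.cast_pow, mul_right_comm, ← pow_add, (hW u hu).dvd_mul_right,
    pow_dvd_pow_iff (by exact_mod_cast hpp.ne_zero) hp] at h
  lia

/-- Nondegenerate symmetric matrices over an algebraically closed field are congruent. -/
theorem exists_transpose_mul_mul_eq {K : Type*} [Field K] [IsAlgClosed K] (h2 : (2 : K) ≠ 0)
    {n : ℕ} (G H : Matrix (Fin n) (Fin n) K) (hGs : G.IsSymm) (hHs : H.IsSymm) (hG : G.det ≠ 0)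
    (hH : H.det ≠ 0) : ∃ M : Matrix (Fin n) (Fin n) K, M.transpose * G * M = H := by
  have : Invertible (2 : K) := invertibleOfNonzero h2
  have hassoc : ∀ A : Matrix (Fin n) (Fin n) K, A.IsSymm →
      QuadraticMap.associated (R := K) (Matrix.toQuadraticForm' A) = Matrix.toLinearMap₂' K A :=
    fun A hA => by
    refine QuadraticMap.associated_left_inverse K fun x y => ?_
    simp only [Matrix.toLinearMap₂'_apply']
    rw [Matrix.dotProduct_mulVec, ← Matrix.mulVec_transpose, hA.eq, dotProduct_comm]
  have hsep : ∀ A : Matrix (Fin n) (Fin n) K, A.IsSymm → A.det ≠ 0 →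
      (QuadraticMap.associated (R := K) (Matrix.toQuadraticForm' A)).SeparatingLeft :=
    fun A hA h => by
      rw [hassoc A hA]
      exact LinearMap.separatingLeft_toLinearMap₂'_of_det_ne_zero' h
  have hmat : ∀ A : Matrix (Fin n) (Fin n) K, A.IsSymm →
      QuadraticForm.toMatrix' (Matrix.toQuadraticForm' A) = A := fun A hA => by
    rw [QuadraticForm.toMatrix', hassoc A hA, LinearMap.toMatrix'_toLinearMap₂']
  obtain ⟨φ⟩ := QuadraticForm.equivalent_of_isAlgClosed _ _ (hsep H hHs hH) (hsep G hGs hG)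
  refine ⟨LinearMap.toMatrix' (φ.toLinearEquiv : (Fin n → K) →ₗ[K] Fin n → K), ?_⟩
  have hcomp : (Matrix.toQuadraticForm' G).comp
      (φ.toLinearEquiv : (Fin n → K) →ₗ[K] Fin n → K) = Matrix.toQuadraticForm' H := by
    ext v
    exact φ.map_app v
  have h := QuadraticForm.toMatrix'_comp (Matrix.toQuadraticForm' G)
    (φ.toLinearEquiv : (Fin n → K) →ₗ[K] Fin n → K)
  rw [hcomp, hmat H hHs, hmat G hGs] at h
  exact h.symm

theorem gram_mul {R : Type*} [CommRing R] {m : ℕ} (G M : Matrix (Fin 3) (Fin 3) R)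
    (z : Matrix (Fin 3) (Fin (m + 1)) R) :
    gram G (M * z) = gram (M.transpose * G * M) z := by
  unfold gram
  simp only [Matrix.transpose_mul, Matrix.mul_assoc]

/-- Over an algebraically closed extension, a conic is equivalent to the determinant form. -/
theorem exists_map_conicFamily_eq {k K : Type*} [Field k] [Field K] [Algebra k K] [IsAlgClosed K]
    (h2 : (2 : K) ≠ 0) (m : ℕ) (G : Matrix (Fin 3) (Fin 3) k) (hs : G.IsSymm) (hG : G.det ≠ 0) :
    ∃ φ : MvPolynomial (Fin 3 × Fin (m + 1)) k →+* MvPolynomial (Fin 3 × Fin (m + 1)) K,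
      ∀ i, φ (conicFamily m G i) = conicFamily m (detForm K) i := by
  obtain ⟨M, hM⟩ := exists_transpose_mul_mul_eq h2 (G.map (algebraMap k K)) (detForm K)
    (hs.map _) (detForm_isSymm K)
    (by rw [← RingHom.mapMatrix_apply, ← RingHom.map_det]; simpa using hG)
    (by simpa [detForm, Matrix.det_fin_three] using h2)
  let z : Matrix (Fin 3) (Fin (m + 1)) (MvPolynomial (Fin 3 × Fin (m + 1)) K) :=
    (M.map C : Matrix (Fin 3) (Fin 3) (MvPolynomial (Fin 3 × Fin (m + 1)) K)) * varMatrix K m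
  let φ : MvPolynomial (Fin 3 × Fin (m + 1)) k →+* MvPolynomial (Fin 3 × Fin (m + 1)) K :=
    eval₂Hom (C.comp (algebraMap k K)) fun p => z p.1 p.2
  refine ⟨φ, fun i => ?_⟩
  have hz : (varMatrix k m).map φ = z := by
    ext1 i j
    simp [φ, varMatrix, z]
  have hC : (G.map C).map φ = (G.map (algebraMap k K)).map C := by
    ext1 i j
    simp [φ]
  have hMC : (M.map C).transpose * (G.map (algebraMap k K)).map C * M.map C =
      (detForm K).map (C : K →+* MvPolynomial (Fin 3 × Fin (m + 1)) K) := by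
    rw [← hM, Matrix.map_mul, Matrix.map_mul, Matrix.transpose_map]
  have hgram : (fun i j => φ (gram (G.map C) (varMatrix k m) i j)) =
      gram ((detForm K).map C) (varMatrix K m) := by
    funext i j
    rw [gram_map, hz, hC]
    exact (congrFun₂ (gram_mul _ _ _) i j).trans (by rw [hMC])
  rw [conicFamily, diagFamily_map, hgram]
  rfl

theorem conicFamily_detForm_map {R S : Type*} [CommRing R] [CommRing S] (m : ℕ) (φ : R →+* S)
    (i : Fin (m + 1) ⊕ Fin (2 * m - 1)) :
    map φ (conicFamily m (detForm R) i) = conicFamily m (detForm S) i := by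
  have hz : (varMatrix R m).map (map φ : MvPolynomial (Fin 3 × Fin (m + 1)) R →+* _) =
      varMatrix S m := by
    ext1 i j
    simp [varMatrix]
  have hC : ((detForm R).map C).map (map φ : MvPolynomial (Fin 3 × Fin (m + 1)) R →+* _) =
      (detForm S).map C := by
    rw [← detForm_map φ]
    ext1 i j
    simp
  rw [conicFamily, diagFamily_map]
  simp only [gram_map, hz, hC]
  rfl

theorem not_forall_conicFamily_pow_mem_of_surjective {W K : Type*} [CommRing W] [IsDomain W]
    [CharZero W] [UniqueFactorizationMonoid W] [CommRing K] (h2 : IsUnit (2 : W)) {m : ℕ}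
    (hm : 1 ≤ m) (p : W)
    (hp : ∀ B D : ℕ, D ≠ 0 → ∃ N, 1 ≤ N ∧ ∃ e : W, ClearsDenominators W (B * N) e ∧
      ¬ p ^ N ∣ D * e)
    (π : W →+* K) (hπ : Function.Surjective π) (hker : RingHom.ker π = Ideal.span {p})
    (f : Fin (m + 1) ⊕ Fin (2 * m - 1) → MvPolynomial (Fin 3 × Fin (m + 1)) K)
    (i₀ : Fin (m + 1) ⊕ Fin (2 * m - 1)) (hf₀ : f i₀ = 0)
    (hf : ∀ i, f i ∈ Ideal.span (Set.range (conicFamily m (detForm K)))) (T : ℕ) (hT : 1 ≤ T) :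
    ¬ ∀ i, conicFamily m (detForm K) i ^ T ∈ Ideal.span (Set.range f) := by
  intro hh
  have hsurj := map_surjective (σ := Fin 3 × Fin (m + 1)) π hπ
  choose c hc using fun i => Ideal.mem_span_range_iff_exists_fun.1 (hf i)
  choose b hb using fun i j => hsurj (c i j)
  let f' : Fin (m + 1) ⊕ Fin (2 * m - 1) → MvPolynomial (Fin 3 × Fin (m + 1)) W := fun i =>
    if i = i₀ then 0 else ∑ j, b i j * conicFamily m (detForm W) j
  have hmap : ∀ i, map π (f' i) = f i := fun i => by
    by_cases hi : i = i₀
    · simp [f', hi, hf₀]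
    · simp [f', hi, hb, conicFamily_detForm_map, ← hc]
  have hf' : ∀ i, f' i ∈ Ideal.span (Set.range (conicFamily m (detForm W))) := fun i => by
    by_cases hi : i = i₀
    · simp [f', hi]
    · simp only [f', if_neg hi]
      exact Ideal.mem_span_range_iff_exists_fun.2 ⟨_, rfl⟩
  refine not_forall_conicFamily_pow_mem W h2 hm p hp f' i₀ (if_pos rfl) hf' T hT fun i => ?_
  have hspan : Ideal.span (Set.range f) = (Ideal.span (Set.range f')).map (map π) := by
    rw [Ideal.map_span, ← Set.range_comp]
    exact congrArg (fun g => Ideal.span (Set.range g)) (funext fun i => (hmap i).symm)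
  have hmem : conicFamily m (detForm W) i ^ T ∈
      ((Ideal.span (Set.range f')).map (map π)).comap (map π) := by
    rw [Ideal.mem_comap, map_pow, conicFamily_detForm_map, ← hspan]
    exact hh i
  rwa [Ideal.comap_map_of_surjective _ hsurj, ← RingHom.ker_eq_comap_bot, ker_map, hker,
    Ideal.map_span, Set.image_singleton] at hmem

theorem isUnit_natCast_wittVector (K : Type*) [Field K] (p : ℕ) [Fact p.Prime] [CharP K p]
    (n : ℕ) (hn : ¬ p ∣ n) : IsUnit (n : WittVector p K) := by
  refine WittVector.isUnit_of_coeff_zero_ne_zero _ ?_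
  have h : WittVector.constantCoeff (n : WittVector p K) = (n : K) := map_natCast _ n
  change WittVector.constantCoeff (n : WittVector p K) ≠ 0
  rwa [h, Ne, CharP.cast_eq_zero_iff K p]

theorem charZero_wittVector (K : Type*) [Field K] (p : ℕ) [Fact p.Prime] [CharP K p] :
    CharZero (WittVector p K) := by
  refine charZero_of_inj_zero fun n hn => ?_
  by_contra hn0
  obtain ⟨d, u, hu, rfl⟩ := Nat.exists_eq_pow_mul_and_not_dvd hn0 p (Fact.out : p.Prime).ne_one
  rw [Nat.cast_mul, Nat.cast_pow] at hn
  exact mul_ne_zero (pow_ne_zero _ (WittVector.p_nonzero p K))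
    (isUnit_natCast_wittVector K p u hu).ne_zero hn

theorem not_forall_conicFamily_pow_mem_of_isAlgClosed (K : Type*) [Field K] [IsAlgClosed K]
    (h2 : (2 : K) ≠ 0) {m : ℕ} (hm : 1 ≤ m)
    (f : Fin (m + 1) ⊕ Fin (2 * m - 1) → MvPolynomial (Fin 3 × Fin (m + 1)) K)
    (i₀ : Fin (m + 1) ⊕ Fin (2 * m - 1)) (hf₀ : f i₀ = 0)
    (hf : ∀ i, f i ∈ Ideal.span (Set.range (conicFamily m (detForm K)))) (T : ℕ) (hT : 1 ≤ T) :
    ¬ ∀ i, conicFamily m (detForm K) i ^ T ∈ Ideal.span (Set.range f) := by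
  obtain hK | ⟨p, hp, hK⟩ := CharP.exists' K
  · refine not_forall_conicFamily_pow_mem_of_surjective (isUnit_iff_ne_zero.2 h2) hm 0
      (fun B D hD => ⟨1, le_rfl, 1, ClearsDenominators.one_of_charZero K _, ?_⟩) (RingHom.id K)
      Function.surjective_id ?_ f i₀ hf₀ hf T hT
    · simpa using hD
    · rw [Ideal.span_singleton_eq_bot.2 rfl]
      exact (RingHom.injective_iff_ker_eq_bot _).1 Function.injective_id
  · have := charZero_wittVector K p
    have hunit := isUnit_natCast_wittVector K p
    have hp2 : ¬ p ∣ 2 := fun h => h2 (by exact_mod_cast (CharP.cast_eq_zero_iff K p 2).2 h)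
    exact not_forall_conicFamily_pow_mem_of_surjective (by exact_mod_cast hunit 2 hp2) hm
      (p : WittVector p K)
      (exists_not_pow_dvd_pow_log _ p hunit (WittVector.irreducible p).not_isUnit)
      WittVector.constantCoeff (WittVector.constantCoeff_surjective p)
      WittVector.ker_constantCoeff f i₀ hf₀ hf T hT

theorem three_mul_le_of_radical_span_eq {k : Type*} [Field k] (h2 : (2 : k) ≠ 0) {m : ℕ}
    (hm : 1 ≤ m) (G : Matrix (Fin 3) (Fin 3) k) (hs : G.IsSymm) (hG : G.det ≠ 0) {r : ℕ}
    (f : Fin r → MvPolynomial (Fin 3 × Fin (m + 1)) k)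
    (hf : (Ideal.span (Set.range f)).radical =
      (Ideal.span (Set.range (conicFamily m G))).radical) : 3 * m ≤ r := by
  by_contra! hr
  have h2' : (2 : AlgebraicClosure k) ≠ 0 := by
    rw [← map_ofNat (algebraMap k (AlgebraicClosure k)) 2]
    exact (map_ne_zero _).2 h2
  obtain ⟨φ, hφ⟩ := exists_map_conicFamily_eq (K := AlgebraicClosure k) h2' m G hs hG
  choose b hb using fun i => show f i ∈ (Ideal.span (Set.range (conicFamily m G))).radical from
    hf ▸ Ideal.le_radical (Ideal.subset_span ⟨i, rfl⟩)
  let g : Fin r → MvPolynomial (Fin 3 × Fin (m + 1)) k := fun i => f i ^ b i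
  have hg : Ideal.span (Set.range (conicFamily m G)) ≤ (Ideal.span (Set.range g)).radical := by
    refine Ideal.le_radical.trans (hf ▸ Ideal.radical_le_radical_iff.2 (Ideal.span_le.2 ?_))
    rintro _ ⟨i, rfl⟩
    exact ⟨b i, Ideal.subset_span ⟨i, rfl⟩⟩
  obtain ⟨T, hT⟩ := Ideal.exists_pow_le_of_le_radical_of_fg hg
    (Submodule.fg_span (Set.finite_range _))
  let ε : Fin (3 * m) ≃ Fin (m + 1) ⊕ Fin (2 * m - 1) :=
    Fintype.equivOfCardEq (by simp; lia)
  let g' : Fin (m + 1) ⊕ Fin (2 * m - 1) →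
      MvPolynomial (Fin 3 × Fin (m + 1)) (AlgebraicClosure k) :=
    fun i => if h : (ε.symm i).val < r then φ (g ⟨_, h⟩) else 0
  refine not_forall_conicFamily_pow_mem_of_isAlgClosed _ h2' hm g' (ε ⟨r, hr⟩) (by simp [g'])
    (fun i => ?_) (T + 1) (by lia) fun i => ?_
  · simp only [g']
    split_ifs with h
    · have := Ideal.mem_map_of_mem φ (hb ⟨_, h⟩)
      rw [Ideal.map_span, ← Set.range_comp] at this
      rwa [← funext hφ]
    · exact zero_mem _
  · have h1 : conicFamily m G i ^ (T + 1) ∈ Ideal.span (Set.range g) :=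
      hT (Ideal.pow_le_pow_right T.le_succ
        (Ideal.pow_mem_pow (Ideal.subset_span (Set.mem_range_self i)) _))
    have h3 := Ideal.mem_map_of_mem φ h1
    rw [map_pow, hφ] at h3
    have hle : (Ideal.span (Set.range g)).map φ ≤ Ideal.span (Set.range g') := by
      rw [Ideal.map_le_iff_le_comap, Ideal.span_le]
      rintro _ ⟨j, rfl⟩
      exact Ideal.subset_span ⟨ε ⟨j, j.2.trans hr⟩, by simp [g']⟩
    exact hle h3

theorem araH_conic_prod_Pm (k : Type*) [Field k] (hk2 : (2 : k) ≠ 0) (m : ℕ) (hm : 1 ≤ m)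
    (F : MvPolynomial (Fin 3) k) (hF : F.IsHomogeneous 2) (hsm : IsSmoothHypersurface F) :
    araH (segreIdeal k 2 m (Ideal.span {F}) ⊥) = 3*m ∧
    (araH (segreIdeal k 2 m (Ideal.span {F}) ⊥) = 2*m + 1 ↔ m = 1) ∧
    (CharZero k →
      ara (segreIdeal k 2 m (Ideal.span {F}) ⊥) = 3*m ∧
      ara (segreIdeal k 2 m (Ideal.span {F}) ⊥)
        = araH (segreIdeal k 2 m (Ideal.span {F}) ⊥)) := by
  obtain ⟨G, hs, hG, hFG⟩ := exists_gram_matrix_of_isSmoothHypersurface hk2 F hF hsm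
  have hrad := radical_span_conicFamily hk2 m F G hs hG hFG
  have hlower : ∀ (r : ℕ) (f : Fin r → MvPolynomial (Fin 3 × Fin (m + 1)) k),
      (Ideal.span (Set.range f)).radical = (segreIdeal k 2 m (Ideal.span {F}) ⊥).radical →
      3 * m ≤ r :=
    fun r f hf => three_mul_le_of_radical_span_eq hk2 hm G hs hG f (hf.trans hrad.symm)
  let ε : Fin (3 * m) ≃ Fin (m + 1) ⊕ Fin (2 * m - 1) := Fintype.equivOfCardEq (by simp; lia)
  have hupper : (Ideal.span (Set.range (conicFamily m G ∘ ε))).radical =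
      (segreIdeal k 2 m (Ideal.span {F}) ⊥).radical := by
    rw [ε.surjective.range_comp, hrad]
  have haraH : araH (segreIdeal k 2 m (Ideal.span {F}) ⊥) = 3 * m := by
    have hmem : ∃ f : Fin (3 * m) → MvPolynomial (Fin 3 × Fin (m + 1)) k,
        (∀ i, ∃ d, (f i).IsHomogeneous d) ∧ (Ideal.span (Set.range f)).radical =
          (segreIdeal k 2 m (Ideal.span {F}) ⊥).radical :=
      ⟨_, fun i => ⟨2, conicFamily_isHomogeneous m G (ε i)⟩, hupper⟩
    exact le_antisymm (Nat.sInf_le hmem)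
      (le_csInf ⟨_, hmem⟩ fun r ⟨f, _, hf⟩ => hlower r f hf)
  have hara : ara (segreIdeal k 2 m (Ideal.span {F}) ⊥) = 3 * m :=
    le_antisymm (Nat.sInf_le ⟨_, hupper⟩) (le_csInf ⟨_, _, hupper⟩ fun r ⟨f, hf⟩ => hlower r f hf)
  exact ⟨haraH, by rw [haraH]; lia, fun _ => ⟨hara, hara.trans haraH.symm⟩⟩
end

section
/- Let k be a field with char(k) ≠ 2, let C = V_+(F) ⊆ P^2 be a smooth conic, and let I ⊆ P = k[z_{ij} : 0 ≤ i ≤ 2, 0 ≤ j ≤ m] be the ideal defining C × P^m ⊆ P^{3m+2}. For i = 0,…,m set F_i = F(z_{0i}, z_{1i}, z_{2i}); for 0 ≤ j < i ≤ m set F_{ij} = Σ_{t=0}^{2} (∂F/∂x_t)(z_{0i}, z_{1i}, z_{2i}) · z_{jt}; and for h = 1,…,2m−1 set G_h = Σ_{i+j=h, j<i} F_{ij}. Then I = √((F_0,…,F_m, G_1,…,G_{2m−1})); in particular these 3m homogeneous polynomials generate I up to radical. -/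
/-!
STATEMENT 15: Let `k` be a field with `char k ≠ 2`, let `C = V₊(F) ⊆ ℙ²` be a smooth conic,
and let `I ⊆ P = k[z_{ij} : 0 ≤ i ≤ 2, 0 ≤ j ≤ m]` be the ideal defining `C × ℙᵐ ⊆ ℙ^{3m+2}`.
For `i = 0,…,m` set `Fᵢ = F(z_{0i}, z_{1i}, z_{2i})`; for `0 ≤ j < i ≤ m` set
`F_{ij} = Σ_{t=0}^{2} (∂F/∂x_t)(z_{0i}, z_{1i}, z_{2i}) · z_{jt}`; and for `h = 1,…,2m−1`
set `G_h = Σ_{i+j=h, j<i} F_{ij}`.  Then `I = √((F₀,…,F_m, G₁,…,G_{2m−1}))`; in particular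
these `3m` homogeneous polynomials generate `I` up to radical.
-/

open MvPolynomial

/-- `Fᵢ = F(z_{0i}, z_{1i}, z_{2i})` -/
noncomputable def conicSubst {k : Type*} [Field k] {m : ℕ} (F : MvPolynomial (Fin 3) k)
    (i : Fin (m+1)) : MvPolynomial (Fin 3 × Fin (m+1)) k :=
  MvPolynomial.aeval (fun s : Fin 3 => X (s, i)) F

/-- `F_{ij} = Σ_{t=0}^{2} (∂F/∂x_t)(z_{0i}, z_{1i}, z_{2i}) · z_{jt}` -/
noncomputable def polarSubst {k : Type*} [Field k] {m : ℕ} (F : MvPolynomial (Fin 3) k)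
    (i j : Fin (m+1)) : MvPolynomial (Fin 3 × Fin (m+1)) k :=
  ∑ t : Fin 3,
    MvPolynomial.aeval (fun s : Fin 3 => X (s, i)) (MvPolynomial.pderiv t F) * X (t, j)

/-- `G_h = Σ_{i+j=h, j<i} F_{ij}` -/
noncomputable def gSum {k : Type*} [Field k] {m : ℕ} (F : MvPolynomial (Fin 3) k)
    (h : ℕ) : MvPolynomial (Fin 3 × Fin (m+1)) k :=
  ∑ p ∈ Finset.univ.filter
      (fun p : Fin (m+1) × Fin (m+1) => p.2 < p.1 ∧ (p.1 : ℕ) + (p.2 : ℕ) = h),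
    polarSubst F p.1 p.2

open Matrix in
/-- In dimension three, a vector isotropic for a nondegenerate symmetric form and orthogonal to a
nonzero isotropic vector is proportional to it. -/
theorem exists_eq_smul_of_isotropic {K : Type*} [Field K] {N : Matrix (Fin 3) (Fin 3) K}
    (hN : ∀ v, N *ᵥ v = 0 → v = 0) (hsymm : N.IsSymm) {u v : Fin 3 → K} (hu : u ≠ 0)
    (huu : u ⬝ᵥ N *ᵥ u = 0) (hvv : v ⬝ᵥ N *ᵥ v = 0) (hvu : v ⬝ᵥ N *ᵥ u = 0) :
    ∃ c : K, v = c • u := by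
  have huv : u ⬝ᵥ N *ᵥ v = 0 := by
    rw [dotProduct_mulVec, ← mulVec_transpose, hsymm.eq, dotProduct_comm, hvu]
  by_contra! hne
  have hw : u ⨯₃ v ≠ 0 := by
    rw [crossProduct_ne_zero_iff_linearIndependent, LinearIndependent.pair_iff' hu]
    exact fun c h => hne c h.symm
  have key : ∀ a : Fin 3 → K, u ⬝ᵥ a = 0 → v ⬝ᵥ a = 0 → ∃ c : K, c • (u ⨯₃ v) = a := by
    intro a h1 h2
    by_contra! h
    refine (crossProduct_ne_zero_iff_linearIndependent.2
      ((LinearIndependent.pair_iff' hw).2 h)) ?_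
    rw [cross_cross_eq_smul_sub_smul, h1, h2, zero_smul, zero_smul, sub_zero]
  obtain ⟨α, hα⟩ := key _ huu hvu
  obtain ⟨β, hβ⟩ := key _ huv hvv
  have hα0 : α ≠ 0 := by
    rintro rfl
    exact hu (hN u (by rw [← hα, zero_smul]))
  have h0 : β • u - α • v = 0 := hN _ (by
    rw [mulVec_sub, mulVec_smul, mulVec_smul, ← hα, ← hβ, smul_smul, smul_smul, mul_comm, sub_self])
  refine hne (α⁻¹ * β) ?_
  rw [mul_smul, sub_eq_zero.1 h0, smul_smul, inv_mul_cancel₀ hα0, one_smul]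

open Matrix in
/-- A sequence of isotropic vectors in a nondegenerate symmetric space of dimension three is
contained in a single isotropic line as soon as the antidiagonal sums of the pairings vanish. -/
theorem exists_isotropic_line {K : Type*} [Field K] {N : Matrix (Fin 3) (Fin 3) K}
    (hN : ∀ v, N *ᵥ v = 0 → v = 0) (hsymm : N.IsSymm) {m : ℕ} (u : Fin (m + 1) → Fin 3 → K)
    (hu : ∀ i, u i ⬝ᵥ N *ᵥ u i = 0)
    (hsum : ∀ h : Fin (2 * m - 1), ∑ p ∈ Finset.univ.filter
      (fun p : Fin (m + 1) × Fin (m + 1) => p.2 < p.1 ∧ (p.1 : ℕ) + (p.2 : ℕ) = h + 1),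
      u p.2 ⬝ᵥ N *ᵥ u p.1 = 0) :
    ∃ (x : Fin 3 → K) (c : Fin (m + 1) → K), x ⬝ᵥ N *ᵥ x = 0 ∧ ∀ i, u i = c i • x := by
  by_cases hzero : ∀ i, u i = 0
  · exact ⟨0, 0, by simp, fun i => by simp [hzero i]⟩
  push Not at hzero
  obtain ⟨r, hr, hmin⟩ := wellFounded_lt.has_min {i | u i ≠ 0} hzero
  have hlt : ∀ i < r, u i = 0 := fun i hi => by
    by_contra h
    exact hmin i h hi
  have hprop : ∀ s, ∃ c : K, u s = c • u r := by
    intro s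
    induction s using WellFoundedLT.induction with
    | ind s ih =>
      rcases lt_trichotomy s r with h | rfl | h
      · exact ⟨0, by rw [hlt s h, zero_smul]⟩
      · exact ⟨1, (one_smul _ _).symm⟩
      · have hs := s.isLt
        have h' : (r : ℕ) < s := h
        have hG := hsum ⟨r + s - 1, by omega⟩
        rw [Finset.sum_eq_single (s, r)] at hG
        · refine exists_eq_smul_of_isotropic hN hsymm hr (hu r) (hu s) ?_
          rw [dotProduct_mulVec, ← mulVec_transpose, hsymm.eq, dotProduct_comm]
          exact hG
        · rintro ⟨i, j⟩ hp hne
          simp only [Finset.mem_filter, Finset.mem_univ, true_and] at hp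
          obtain ⟨hji, hadd⟩ := hp
          rcases lt_trichotomy j r with hj | rfl | hj
          · simp [hlt j hj]
          · have hi : i = s := Fin.ext (by omega)
            exact absurd (by rw [hi]) hne
          · have hj' : (r : ℕ) < j := hj
            have hi : i < s := Fin.lt_def.2 (by omega)
            obtain ⟨a, ha⟩ := ih i hi
            obtain ⟨b, hb⟩ := ih j (hji.trans hi)
            simp [ha, hb, mulVec_smul, hu r]
        · intro hnot
          refine absurd ?_ hnot
          simp only [Finset.mem_filter, Finset.mem_univ, true_and]
          exact ⟨h, by omega⟩
  choose c hc using hprop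
  exact ⟨u r, c, hu r, hc⟩

namespace MvPolynomial

theorem IsHomogeneous.eq_sum_coeff_mul_X {σ R : Type*} [Fintype σ] [CommRing R]
    {f : MvPolynomial σ R} (hf : f.IsHomogeneous 1) :
    f = ∑ j, C (coeff (Finsupp.single j 1) f) * X j := by
  classical
  have hmem : f ∈ homogeneousSubmodule σ R 1 := hf
  rw [homogeneousSubmodule_one_eq_span_X, Submodule.mem_span_range_iff_exists_fun] at hmem
  obtain ⟨c, rfl⟩ := hmem
  refine Finset.sum_congr rfl fun j _ => ?_
  rw [coeff_sum, Finset.sum_eq_single j]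
  · simp [smul_eq_C_mul]
  · intro b _ hb
    simp [coeff_X, Finsupp.single_left_inj, hb]
  · simp

/-- The Hessian matrix of a quadratic form. -/
noncomputable def hessian {σ R : Type*} [CommRing R] (F : MvPolynomial σ R) : Matrix σ σ R :=
  fun i j => coeff (Finsupp.single j 1) (pderiv i F)

theorem hessian_isSymm {σ R : Type*} [CommRing R] (F : MvPolynomial σ R) :
    (hessian F).IsSymm := by
  classical
  ext i j
  simp only [Matrix.transpose_apply, hessian, coeff_pderiv, Finsupp.single_apply, eq_comm (a := i)]
  rw [add_comm]

section Quadratic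

open Matrix

variable {σ R : Type*} [Fintype σ] [Field R] {F : MvPolynomial σ R}

theorem IsHomogeneous.pderiv_eq_sum_hessian (hF : F.IsHomogeneous 2) (i : σ) :
    pderiv i F = ∑ j, C (hessian F i j) * X j :=
  (hF.pderiv (i := i)).eq_sum_coeff_mul_X

theorem IsHomogeneous.aeval_pderiv_eq_hessian (hF : F.IsHomogeneous 2) {A : Type*} [CommRing A]
    [Algebra R A] (u : σ → A) (i : σ) :
    MvPolynomial.aeval u (pderiv i F) = ((hessian F).map (algebraMap R A) *ᵥ u) i := by
  rw [hF.pderiv_eq_sum_hessian]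
  simp [mulVec, dotProduct]

theorem IsHomogeneous.two_mul_aeval_eq_hessian (hF : F.IsHomogeneous 2) {A : Type*} [CommRing A]
    [Algebra R A] (u : σ → A) :
    2 * MvPolynomial.aeval u F = u ⬝ᵥ (hessian F).map (algebraMap R A) *ᵥ u := by
  have h := congrArg (MvPolynomial.aeval u) hF.sum_X_mul_pderiv
  rw [map_sum, nsmul_eq_mul, map_mul] at h
  simp only [map_mul, aeval_X, hF.aeval_pderiv_eq_hessian] at h
  rw [dotProduct, h]
  simp

theorem IsHomogeneous.squarefree_rename [DecidableEq σ] {τ : Type*} {f : σ → τ}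
    (hf : Function.Injective f) (hF : F.IsHomogeneous 2) (hdet : (hessian F).det ≠ 0)
    [Nontrivial σ] : Squarefree (rename f F) := by
  rintro A ⟨B, hB⟩
  have hpd : ∀ i, A ∣ rename f (pderiv i F) := fun i => by
    rw [← pderiv_rename hf, hB, mul_assoc, pderiv_mul]
    refine dvd_add ((dvd_mul_right A B).mul_left _) (dvd_mul_right _ _)
  have hX : ∀ l, A ∣ X (f l) := fun l => by
    have hcomb : (X l : MvPolynomial σ R) = ∑ i, C ((hessian F)⁻¹ l i) * pderiv i F := by
      simp_rw [hF.pderiv_eq_sum_hessian, Finset.mul_sum, ← mul_assoc, ← map_mul]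
      rw [Finset.sum_comm]
      simp_rw [← Finset.sum_mul, ← map_sum, ← Matrix.mul_apply,
        nonsing_inv_mul _ (isUnit_iff_ne_zero.2 hdet), Matrix.one_apply]
      simp
    rw [← rename_X f l, hcomb, map_sum]
    exact Finset.dvd_sum fun i _ => by
      rw [map_mul]
      exact (hpd i).mul_left _
  obtain ⟨a, b, hab⟩ := exists_pair_ne σ
  by_contra hA
  have h := ((X_prime (R := R) (i := f a)).irreducible.dvd_iff.1 (hX a)).resolve_left hA
  have h' := h.dvd.trans (hX b)
  exact hab (hf (X_dvd_X.1 h'))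

end Quadratic

end MvPolynomial

open Matrix in
theorem IsSmoothHypersurface.eq_zero_of_hessian_mulVec {k : Type*} [Field k] (hk2 : (2 : k) ≠ 0)
    {n : ℕ} {F : MvPolynomial (Fin (n + 1)) k} (hF : F.IsHomogeneous 2)
    (hsm : IsSmoothHypersurface F) (v : Fin (n + 1) → AlgebraicClosure k)
    (hv : (hessian F).map (algebraMap k (AlgebraicClosure k)) *ᵥ v = 0) : v = 0 := by
  by_contra hne
  have h2 : (2 : AlgebraicClosure k) ≠ 0 := by
    rw [← map_ofNat (algebraMap k (AlgebraicClosure k)) 2]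
    simpa using hk2
  refine hsm v hne ⟨?_, fun i => ?_⟩
  · have h := hF.two_mul_aeval_eq_hessian v
    rw [hv, dotProduct_zero] at h
    rw [eval_map, ← aeval_def]
    exact (mul_eq_zero.1 h).resolve_left h2
  · rw [eval_map, ← aeval_def, hF.aeval_pderiv_eq_hessian, hv, Pi.zero_apply]

theorem IsSmoothHypersurface.det_hessian_ne_zero {k : Type*} [Field k] (hk2 : (2 : k) ≠ 0)
    {n : ℕ} {F : MvPolynomial (Fin (n + 1)) k} (hF : F.IsHomogeneous 2)
    (hsm : IsSmoothHypersurface F) : (hessian F).det ≠ 0 := by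
  intro h
  have h' : ((hessian F).map (algebraMap k (AlgebraicClosure k))).det = 0 := by
    rw [← RingHom.mapMatrix_apply, ← RingHom.map_det, h, map_zero]
  obtain ⟨v, hv, hv0⟩ := Matrix.exists_mulVec_eq_zero_iff.2 h'
  exact hv (hsm.eq_zero_of_hessian_mulVec hk2 hF v hv0)

theorem mem_segreIdeal_span_singleton_bot {k : Type*} [Field k] {n m : ℕ}
    {F : MvPolynomial (Fin (n + 1)) k} {f : MvPolynomial (Fin (n + 1) × Fin (m + 1)) k} :
    f ∈ segreIdeal k n m (Ideal.span {F}) ⊥ ↔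
      rename (Sum.inl : Fin (n + 1) → Fin (n + 1) ⊕ Fin (m + 1)) F ∣
        aeval (fun p : Fin (n + 1) × Fin (m + 1) =>
          (X (Sum.inl p.1) * X (Sum.inr p.2) : MvPolynomial (Fin (n + 1) ⊕ Fin (m + 1)) k)) f := by
  have hmk (J : Ideal (MvPolynomial (Fin (n + 1) ⊕ Fin (m + 1)) k)) :
      aeval (fun p : Fin (n + 1) × Fin (m + 1) =>
        Ideal.Quotient.mk J (X (Sum.inl p.1) * X (Sum.inr p.2))) f
        = Ideal.Quotient.mk J (aeval (fun p => X (Sum.inl p.1) * X (Sum.inr p.2)) f) :=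
    (comp_aeval_apply _ (Ideal.Quotient.mkₐ k J) f).symm
  rw [segreIdeal, RingHom.mem_ker, hmk, Ideal.Quotient.eq_zero_iff_mem, Ideal.map_bot, sup_bot_eq,
    Ideal.map_span, Set.image_singleton, Ideal.mem_span_singleton]

open Matrix in
theorem aeval_polarSubst {k A : Type*} [Field k] [CommRing A] [Algebra k A] {m : ℕ}
    {F : MvPolynomial (Fin 3) k} (hF : F.IsHomogeneous 2) (p : Fin 3 × Fin (m + 1) → A)
    (i j : Fin (m + 1)) :
    aeval p (polarSubst F i j) = (fun s => p (s, j)) ⬝ᵥ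
      (hessian F).map (algebraMap k A) *ᵥ (fun s => p (s, i)) := by
  simp only [polarSubst, map_sum, map_mul, comp_aeval_apply, aeval_X]
  simp only [hF.aeval_pderiv_eq_hessian]
  exact Finset.sum_congr rfl fun t _ => mul_comm _ _

theorem aeval_conicSubst {k A : Type*} [Field k] [CommRing A] [Algebra k A] {m : ℕ}
    (F : MvPolynomial (Fin 3) k) (p : Fin 3 × Fin (m + 1) → A) (i : Fin (m + 1)) :
    aeval p (conicSubst F i) = aeval (fun s => p (s, i)) F := by
  simp only [conicSubst, comp_aeval_apply, aeval_X]


theorem conic_prod_Pm_explicit_generators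
    (k : Type*) [Field k] (hk2 : (2 : k) ≠ 0) (m : ℕ) (hm : 1 ≤ m)
    (F : MvPolynomial (Fin 3) k) (hF : F.IsHomogeneous 2) (hsm : IsSmoothHypersurface F) :
    segreIdeal k 2 m (Ideal.span {F}) ⊥
      = (Ideal.span
          ((Set.range fun i : Fin (m+1) => conicSubst (m := m) F i) ∪
           (Set.range fun h : Fin (2*m-1) => gSum (m := m) F (h + 1)))).radical := by
  apply le_antisymm
  · rw [← vanishingIdeal_zeroLocus_eq_radical (K := AlgebraicClosure k)]
    intro f hf p hp
    rw [zeroLocus_span] at hp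
    obtain ⟨x, c, hx, hc⟩ := exists_isotropic_line (hsm.eq_zero_of_hessian_mulVec hk2 hF)
      ((hessian_isSymm F).map _) (fun i s => p (s, i))
      (fun i => by
        rw [← hF.two_mul_aeval_eq_hessian, ← aeval_conicSubst, hp _ (Or.inl ⟨i, rfl⟩), mul_zero])
      (fun h => by
        have h0 := hp _ (Or.inr ⟨h, rfl⟩)
        simpa only [gSum, map_sum, aeval_polarSubst hF] using h0)
    have h2 : (2 : AlgebraicClosure k) ≠ 0 := by
      rw [← map_ofNat (algebraMap k (AlgebraicClosure k)) 2]
      simpa using hk2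
    rw [← hF.two_mul_aeval_eq_hessian] at hx
    have hFx := (mul_eq_zero.1 hx).resolve_left h2
    have hdvd := map_dvd (aeval (Sum.elim x c)) (mem_segreIdeal_span_singleton_bot.1 hf)
    rw [aeval_rename, Sum.elim_comp_inl, hFx, zero_dvd_iff, comp_aeval_apply] at hdvd
    rw [← hdvd]
    congr 2
    funext q
    have := congrFun (hc q.2) q.1
    simpa [mul_comm] using this
  · have hrad : IsRadical (rename (Sum.inl : Fin 3 → Fin 3 ⊕ Fin (m + 1)) F) :=
      (hF.squarefree_rename Sum.inl_injective (hsm.det_hessian_ne_zero hk2 hF)).isRadical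
    have hle : Ideal.span
        ((Set.range fun i : Fin (m+1) => conicSubst (m := m) F i) ∪
          (Set.range fun h : Fin (2*m-1) => gSum (m := m) F (h + 1)))
        ≤ segreIdeal k 2 m (Ideal.span {F}) ⊥ := by
      have h2 : IsUnit (2 : MvPolynomial (Fin 3 ⊕ Fin (m + 1)) k) := by
        rw [← map_ofNat (C (σ := Fin 3 ⊕ Fin (m + 1)) (R := k)) 2]
        exact (isUnit_iff_ne_zero.2 hk2).map C
      have hX := hF.two_mul_aeval_eq_hessian
        (X ∘ Sum.inl : Fin 3 → MvPolynomial (Fin 3 ⊕ Fin (m + 1)) k)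
      rw [← aeval_rename, aeval_X_left_apply] at hX
      have hsmul : ∀ i : Fin (m + 1), (fun s : Fin 3 =>
          (X (Sum.inl s) * X (Sum.inr i) : MvPolynomial (Fin 3 ⊕ Fin (m + 1)) k))
          = (X (Sum.inr i) : MvPolynomial (Fin 3 ⊕ Fin (m + 1)) k) • (X ∘ Sum.inl) := fun i =>
        funext fun s => mul_comm _ _
      rw [Ideal.span_le]
      rintro _ (⟨i, rfl⟩ | ⟨h, rfl⟩)
      · refine mem_segreIdeal_span_singleton_bot.2 ?_
        rw [← h2.dvd_mul_left, aeval_conicSubst, hF.two_mul_aeval_eq_hessian, hsmul,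
          Matrix.mulVec_smul, smul_dotProduct, dotProduct_smul, ← hX]
        exact ⟨X (Sum.inr i) * X (Sum.inr i) * 2, by simp only [smul_eq_mul]; ring⟩
      · refine mem_segreIdeal_span_singleton_bot.2 ?_
        simp only [gSum, map_sum, aeval_polarSubst hF]
        refine Finset.dvd_sum fun q _ => ?_
        rw [hsmul, hsmul, Matrix.mulVec_smul, smul_dotProduct, dotProduct_smul, ← hX]
        exact ⟨X (Sum.inr q.2) * X (Sum.inr q.1) * 2, by simp only [smul_eq_mul]; ring⟩
    rintro f ⟨N, hN⟩
    have hf := mem_segreIdeal_span_singleton_bot.1 (hle hN)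
    rw [map_pow] at hf
    exact mem_segreIdeal_span_singleton_bot.2 (hrad N _ hf)
end

section
/- Let A be a commutative ring, R a Noetherian A-algebra, a ⊆ R a (finitely generated) ideal, B a flat A-algebra, R_B = R ⊗_A B, M an R-module, and M_B = M ⊗_A B. Then for every j ∈ ℕ there is an isomorphism H_a^j(M) ⊗_A B ≅ H_{aR_B}^j(M_B) of local cohomology modules. -/
/-!
STATEMENT 17: Let `A` be a commutative ring, `R` a Noetherian `A`-algebra, `a ⊆ R` a
(finitely generated) ideal, `B` a flat `A`-algebra, `R_B = R ⊗_A B`, `M` an `R`-module, and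
`M_B = M ⊗_A B`.  Then for every `j ∈ ℕ` there is an isomorphism
`H_a^j(M) ⊗_A B ≅ H_{aR_B}^j(M_B)` of local cohomology modules.

Here `R_B = R ⊗[A] B`, the base change `M_B = M ⊗_A B` of `M` is realised by its canonical
`R_B`-module incarnation `R_B ⊗[R] M`, the left-hand side `H_a^j(M) ⊗_A B` is realised as
`B ⊗[A] H_a^j(M)`, and the isomorphism is `B`-linear (both sides being `B`-modules via the
inclusion `B → R_B`); this is the statement that local cohomology commutes with flat base
change.
-/

open CategoryTheory TensorProduct

section
variable {C C' D D' : Type*} [Category* C] [Category* C'] [Category* D] [Category* D']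
  [Abelian C] [Abelian C'] [Abelian D] [Abelian D']
  {E : C ⥤ C'} [E.Additive] {F : C ⥤ D} [F.Additive] {F' : C' ⥤ D'} [F'.Additive]
  {G : D ⥤ D'} [G.Additive] [G.PreservesHomology]

namespace HomologicalComplex

variable {ι : Type*} {c : ComplexShape ι}

/-- A natural transformation `E ⋙ F' ⟶ F ⋙ G` with `G` exact induces a comparison morphism from
the homology of `F' (E K)` to the image under `G` of the homology of `F K`. -/
noncomputable def homologyComparison (α : E ⋙ F' ⟶ F ⋙ G) (K : HomologicalComplex C c) (n : ι) :
    ((F'.mapHomologicalComplex c).obj ((E.mapHomologicalComplex c).obj K)).homology n ⟶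
      G.obj (((F.mapHomologicalComplex c).obj K).homology n) :=
  homologyMap ((NatTrans.mapHomologicalComplex α c).app K) n ≫
    ((((F.mapHomologicalComplex c).obj K).sc n).mapHomologyIso G).hom

lemma isIso_homologyComparison (α : E ⋙ F' ⟶ F ⋙ G) (K : HomologicalComplex C c) (n : ι)
    (h : ∀ i, IsIso (α.app (K.X i))) : IsIso (homologyComparison α K n) := by
  have : ∀ i, IsIso (((NatTrans.mapHomologicalComplex α c).app K).f i) := h
  have := Hom.isIso_of_components ((NatTrans.mapHomologicalComplex α c).app K)
  have : IsIso (homologyMap ((NatTrans.mapHomologicalComplex α c).app K) n) :=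
    inferInstanceAs (IsIso ((homologyFunctor _ _ n).map _))
  exact IsIso.comp_isIso' this (Iso.isIso_hom _)

lemma homologyComparison_naturality (α : E ⋙ F' ⟶ F ⋙ G) {K L : HomologicalComplex C c}
    (φ : K ⟶ L) (n : ι) :
    homologyMap ((F'.mapHomologicalComplex c).map ((E.mapHomologicalComplex c).map φ)) n ≫
        homologyComparison α L n =
      homologyComparison α K n ≫ G.map (homologyMap ((F.mapHomologicalComplex c).map φ) n) := by
  have h₃ := ShortComplex.mapHomologyIso_hom_naturality (F := G)
    ((shortComplexFunctor _ _ n).map ((F.mapHomologicalComplex c).map φ))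
  have h₄ := congr_arg (fun φ => homologyMap φ n)
    ((NatTrans.mapHomologicalComplex α c).naturality φ)
  simp only [homologyMap_comp] at h₄
  exact ((CommSq.mk h₄.symm).horiz_comp (CommSq.mk h₃.symm)).w.symm

end HomologicalComplex

namespace CategoryTheory.ProjectiveResolution

variable [HasProjectiveResolutions C] [HasProjectiveResolutions C']
  [E.PreservesHomology] [E.PreservesProjectiveObjects]

/-- The comparison morphism from the left derived functors of `F'` at `E.obj X` to the image
under the exact functor `G` of those of `F` at `X`, computed by a projective resolution of `X`. -/
noncomputable def leftDerivedComparison {X : C} (P : ProjectiveResolution X)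
    (α : E ⋙ F' ⟶ F ⋙ G) (n : ℕ) :
    (F'.leftDerived n).obj (E.obj X) ⟶ G.obj ((F.leftDerived n).obj X) :=
  ((E.mapProjectiveResolution P).isoLeftDerivedObj F' n).hom ≫
    HomologicalComplex.homologyComparison α P.complex n ≫ G.map (P.isoLeftDerivedObj F n).inv

lemma isIso_leftDerivedComparison {X : C} (P : ProjectiveResolution X)
    (α : E ⋙ F' ⟶ F ⋙ G) (n : ℕ) (h : ∀ i, IsIso (α.app (P.complex.X i))) :
    IsIso (P.leftDerivedComparison α n) := by
  have := HomologicalComplex.isIso_homologyComparison α P.complex n h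
  exact IsIso.comp_isIso' (Iso.isIso_hom _)
    (IsIso.comp_isIso' this (G.mapIso (P.isoLeftDerivedObj F n)).isIso_inv)

lemma leftDerivedComparison_naturality {X Y : C} (f : X ⟶ Y) (P : ProjectiveResolution X)
    (Q : ProjectiveResolution Y) (α : E ⋙ F' ⟶ F ⋙ G) (n : ℕ) :
    (F'.leftDerived n).map (E.map f) ≫ Q.leftDerivedComparison α n =
      P.leftDerivedComparison α n ≫ G.map ((F.leftDerived n).map f) := by
  have comm := lift_commutes_zero f P Q
  have h₁ := isoLeftDerivedObj_inv_naturality f P Q (lift f P Q) comm F n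
  have h₂ := isoLeftDerivedObj_hom_naturality (E.map f) (E.mapProjectiveResolution P)
    (E.mapProjectiveResolution Q) ((E.mapHomologicalComplex _).map (lift f P Q))
    (by
      have e {Z : C} (R : ProjectiveResolution Z) :
          (E.mapProjectiveResolution R).π.f 0 = E.map (R.π.f 0) := by
        refine (congr_arg (E.map (R.π.f 0) ≫ ·)
          (HomologicalComplex.singleMapHomologicalComplex_hom_app_self E _ 0 Z)).trans ?_
        simp
      rw [e, e]
      exact (E.map_comp _ _).symm.trans ((congr_arg E.map comm).trans (E.map_comp _ _))) F' n
  have h₃ := HomologicalComplex.homologyComparison_naturality α (lift f P Q) n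
  have h₄ : G.map ((F.mapHomologicalComplex _ ⋙ HomologicalComplex.homologyFunctor _ _ n).map
      (lift f P Q)) ≫ G.map (Q.isoLeftDerivedObj F n).inv =
      G.map (P.isoLeftDerivedObj F n).inv ≫ G.map ((F.leftDerived n).map f) := by
    rw [← G.map_comp, ← G.map_comp, h₁]
  exact ((CommSq.mk h₂.symm).horiz_comp
    ((CommSq.mk h₃.symm).horiz_comp (CommSq.mk h₄.symm))).w.symm

end CategoryTheory.ProjectiveResolution
end

namespace FGModuleCat

variable {R : Type} [CommRing R] [IsNoetherianRing R]

lemma projective_of_fin_fun (n : ℕ) : Projective (FGModuleCat.of R (Fin n → R)) := by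
  have : Projective ((forget₂ (FGModuleCat.{0} R) (ModuleCat R)).obj
      (FGModuleCat.of R (Fin n → R))) :=
    (IsProjective.iff_projective (Fin n → R)).1 inferInstance
  exact (forget₂ (FGModuleCat.{0} R) (ModuleCat R)).projective_of_map_projective this

lemma epi_ofHom {M N : Type} [AddCommGroup M] [Module R M] [Module.Finite R M]
    [AddCommGroup N] [Module R N] [Module.Finite R N] (g : M →ₗ[R] N)
    (hg : Function.Surjective g) : Epi (FGModuleCat.ofHom g) :=
  (forget₂ (FGModuleCat.{0} R) (ModuleCat R)).epi_of_epi_map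
    ((ModuleCat.epi_iff_surjective _).2 hg)

instance : EnoughProjectives (FGModuleCat.{0} R) where
  presentation M := by
    obtain ⟨n, g, hg⟩ := Module.Finite.exists_fin' R M
    exact ⟨{ p := FGModuleCat.of R (Fin n → R)
             projective := projective_of_fin_fun n
             f := FGModuleCat.ofHom g
             epi := epi_ofHom g hg }⟩

instance : (forget₂ (FGModuleCat.{0} R) (ModuleCat R)).PreservesProjectiveObjects where
  projective_obj {P} hP := by
    obtain ⟨n, g, hg⟩ := Module.Finite.exists_fin' R P
    have := epi_ofHom g hg
    let F := forget₂ (FGModuleCat.{0} R) (ModuleCat R)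
    have : Projective (F.obj (FGModuleCat.of R (Fin n → R))) :=
        (IsProjective.iff_projective (Fin n → R)).1 inferInstance
    have h := Projective.factorThru_comp (𝟙 P) (FGModuleCat.ofHom g)
    let r : Retract (F.obj P) (F.obj (FGModuleCat.of R (Fin n → R))) :=
      { i := F.map (Projective.factorThru (𝟙 P) (FGModuleCat.ofHom g))
        r := F.map (FGModuleCat.ofHom g)
        retract := (F.map_comp _ _).symm.trans ((congr_arg F.map h).trans (F.map_id _)) }
    exact r.projective

end FGModuleCat

namespace ModuleCat

open CategoryTheory.Limits

theorem exists_projectiveResolution_finite {R : Type} [CommRing R] [IsNoetherianRing R]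
    (X : ModuleCat.{0} R) [Module.Finite R X] :
    ∃ P : ProjectiveResolution X, ∀ i, Module.Finite R (P.complex.X i) :=
  let Q := ProjectiveResolution.of (FGModuleCat.of R X)
  ⟨(forget₂ (FGModuleCat.{0} R) (ModuleCat R)).mapProjectiveResolution Q,
    fun i => (Q.complex.X i).property⟩

variable {R S : Type} [CommRing R] [CommRing S] (f : R →+* S)

instance : (extendScalars.{_, _, 0} f).Additive :=
  (extendRestrictScalarsAdj f).left_adjoint_additive

instance : (extendScalars.{_, _, 0} f).PreservesProjectiveObjects where
  projective_obj {P} hP := (extendRestrictScalarsAdj f).map_projective P hP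

lemma preservesHomology_extendScalars (hf : f.Flat) :
    (extendScalars.{_, _, 0} f).PreservesHomology := by
  have := preservesFiniteLimits_extendScalars_of_flat hf
  infer_instance

lemma preservesHomology_extendScalars_op (hf : f.Flat) :
    (extendScalars.{_, _, 0} f).op.PreservesHomology := by
  have := preservesFiniteLimits_extendScalars_of_flat hf
  have := preservesFiniteLimits_op (extendScalars.{_, _, 0} f)
  have := preservesFiniteColimits_op (extendScalars.{_, _, 0} f)
  infer_instance

/-- The base change map on homomorphisms, for the extension of scalars along `f`. -/
noncomputable def extendScalarsHom (X M : ModuleCat.{0} R) :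
    (extendScalars f).obj (ModuleCat.of R (X ⟶ M)) ⟶
      ModuleCat.of S ((extendScalars f).obj X ⟶ (extendScalars f).obj M) :=
  ((extendRestrictScalarsAdj f).homEquiv _ _).symm (ModuleCat.ofHom (Y := (restrictScalars f).obj
    (ModuleCat.of S ((extendScalars f).obj X ⟶ (extendScalars f).obj M)))
    { toFun := fun φ => (extendScalars f).map φ
      map_add' := fun φ ψ => (extendScalars f).map_add
      map_smul' := fun r φ => by
        refine ExtendScalars.hom_ext fun x => ?_
        refine Eq.trans ?_ (ExtendScalars.smul_tmul f (f r) 1 (φ.hom x)).symm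
        let := f.toAlgebra
        exact (TensorProduct.smul_tmul r (1 : S) (φ.hom x)).symm.trans
          (congr_arg (· ⊗ₜ[R] φ.hom x) (Algebra.smul_def r (1 : S))) })

open ChangeOfRings in
lemma extendScalarsHom_tmul (X M : ModuleCat.{0} R) (s : S) (φ : X ⟶ M) :
    (extendScalarsHom f X M).hom (s ⊗ₜ[R,f] φ : ) = s • (extendScalars f).map φ := by
  rfl

lemma isIso_extendScalarsHom [IsNoetherianRing R] (hf : f.Flat) (X M : ModuleCat.{0} R)
    [Module.Finite R X] : IsIso (extendScalarsHom f X M) := by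
  let := f.toAlgebra
  have : Module.Flat R S := hf
  have := Module.finitePresentation_of_finite R X
  have h := Module.FinitePresentation.isBaseChange_map R X M S
  let e₁ : (extendScalars f).obj (of R (X ⟶ M)) ≃ₗ[S] (S ⊗[R] (X →ₗ[R] M)) :=
    (ModuleCat.homLinearEquiv (S := R)).baseChange R S _ _
  let e₂ : (S ⊗[R] X →ₗ[S] S ⊗[R] M) ≃ₗ[S]
      of S ((extendScalars f).obj X ⟶ (extendScalars f).obj M) :=
    (ModuleCat.homLinearEquiv (S := S) (M := (extendScalars f).obj X)
      (N := (extendScalars f).obj M)).symm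
  have key : extendScalarsHom f X M = (e₁ ≪≫ₗ h.equiv ≪≫ₗ e₂).toModuleIso.hom := by
    refine ExtendScalars.hom_ext fun φ => ?_
    refine (extendScalarsHom_tmul f X M 1 φ).trans ?_
    change _ = e₂ (h.equiv ((1 : S) ⊗ₜ[R] φ.hom))
    rw [h.equiv_tmul, one_smul, one_smul]
    rfl
  rw [key]
  infer_instance

/-- Naturality of `extendScalarsHom` in its first variable, in terms of the Yoneda functors. -/
noncomputable def extendScalarsLinearYoneda (M : ModuleCat.{0} R) :
    extendScalars f ⋙ ((linearYoneda S (ModuleCat.{0} S)).obj ((extendScalars f).obj M)).rightOp ⟶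
      ((linearYoneda R (ModuleCat.{0} R)).obj M).rightOp ⋙ (extendScalars f).op where
  app X := (extendScalarsHom f X M).op
  naturality X Y g := by
    refine Quiver.Hom.unop_inj (ExtendScalars.hom_ext fun φ => ?_)
    refine (congr_arg ((extendScalars f).map g ≫ ·) (extendScalarsHom_tmul f Y M 1 φ)).trans
      (Eq.trans ?_ (extendScalarsHom_tmul f X M 1 (g ≫ φ)).symm)
    simp only [one_smul]
    exact ((extendScalars f).map_comp g φ).symm

/-- `Ext` of a finite module over a Noetherian ring commutes with flat extension of scalars. -/
noncomputable def extendScalarsExtIso [IsNoetherianRing R] (hf : f.Flat) (X M : ModuleCat.{0} R)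
    [Module.Finite R X] (P : ProjectiveResolution X) (hP : ∀ i, Module.Finite R (P.complex.X i))
    (n : ℕ) :
    (extendScalars f).obj (((Ext R (ModuleCat.{0} R) n).obj (.op X)).obj M) ≅
      ((Ext S (ModuleCat.{0} S) n).obj (.op ((extendScalars f).obj X))).obj
        ((extendScalars f).obj M) :=
  have := preservesHomology_extendScalars f hf
  have := preservesHomology_extendScalars_op f hf
  have (i : ℕ) : IsIso ((extendScalarsLinearYoneda f M).app (P.complex.X i)) :=
    have := hP i
    have := isIso_extendScalarsHom f hf (P.complex.X i) M
    inferInstanceAs (IsIso (extendScalarsHom f (P.complex.X i) M).op)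
  have := P.isIso_leftDerivedComparison (extendScalarsLinearYoneda f M) n this
  (asIso (P.leftDerivedComparison (extendScalarsLinearYoneda f M) n)).unop

/-- `Ext` commutes with flat extension of scalars, naturally along a diagram of finite modules
over a Noetherian ring. -/
noncomputable def extendScalarsExtNatIso [IsNoetherianRing R] (hf : f.Flat)
    {D : Type*} [Category* D]
    (K : D ⥤ ModuleCat.{0} R) (M : ModuleCat.{0} R)
    (hK : ∀ t, Module.Finite R (K.obj t)) (n : ℕ) :
    (K.op ⋙ Ext R (ModuleCat.{0} R) n) ⋙ (evaluation _ _).obj M ⋙ extendScalars f ≅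
      ((K ⋙ extendScalars f).op ⋙ Ext S (ModuleCat.{0} S) n) ⋙
        (evaluation _ _).obj ((extendScalars f).obj M) :=
  have h (t : D) := exists_projectiveResolution_finite (K.obj t)
  NatIso.ofComponents (fun t => extendScalarsExtIso f hf (K.obj t.unop) M (h t.unop).choose
    (h t.unop).choose_spec n) fun {t u} g => by
      have := preservesHomology_extendScalars f hf
      have := preservesHomology_extendScalars_op f hf
      exact congr_arg Quiver.Hom.unop (ProjectiveResolution.leftDerivedComparison_naturality
        (K.map g.unop) (h u.unop).choose (h t.unop).choose (extendScalarsLinearYoneda f M) n).symm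

/-- `extendScalars` is the usual base change for any algebra structure inducing `f`. -/
noncomputable def extendScalarsObjIso (M : ModuleCat.{0} R) [alg : Algebra R S]
    (h : algebraMap R S = f) :
    (extendScalars f).obj M ≅ of S (S ⊗[R] M) := by
  obtain rfl : alg = f.toAlgebra := Algebra.algebra_ext _ _ (fun r => by rw [h]; rfl)
  exact Iso.refl _

/-- The extension of scalars of `R ⧸ I` is `S ⧸ J`, where `J` is the extension of `I`. -/
noncomputable def extendScalarsQuotientIso (I : Ideal R) (J : Ideal S) (h : J = I.map f) :
    (extendScalars f).obj (of R (R ⧸ I)) ≅ of S (S ⧸ J) :=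
  letI := f.toAlgebra
  ((Algebra.TensorProduct.quotIdealMapEquivTensorQuot S I).symm.toLinearEquiv ≪≫ₗ
    Submodule.quotEquivOfEq _ _ h.symm).toModuleIso

open ChangeOfRings in
lemma extendScalarsQuotientIso_hom_tmul (I : Ideal R) (J : Ideal S) (h : J = I.map f)
    (s : S) (r : R) :
    (extendScalarsQuotientIso f I J h).hom (s ⊗ₜ[R,f] (Ideal.Quotient.mk I r : R ⧸ I) :) =
      Ideal.Quotient.mk J (s * f r) := by
  let := f.toAlgebra
  have key : (Algebra.TensorProduct.quotIdealMapEquivTensorQuot S I).symm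
      (s ⊗ₜ[R] (Ideal.Quotient.mk I r)) = Ideal.Quotient.mk _ (s * f r) := by
    refine (Algebra.TensorProduct.quotIdealMapEquivTensorQuot_symm_tmul S I s r).trans ?_
    rw [Algebra.smul_def, mul_comm]
    rfl
  exact congr_arg (Submodule.quotEquivOfEq _ _ h.symm) key

/-- Extending the ideals of a diagram extends the scalars of the diagram of quotients. -/
noncomputable def ringModIdealsExtendScalarsIso {D : Type} [SmallCategory D] (I : D ⥤ Ideal R)
    (J : D ⥤ Ideal S) (h : ∀ t, J.obj t = (I.obj t).map f) :
    localCohomology.ringModIdeals I ⋙ extendScalars f ≅ localCohomology.ringModIdeals J :=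
  NatIso.ofComponents (fun t => extendScalarsQuotientIso f _ _ (h t)) fun {t u} g => by
    refine ExtendScalars.hom_ext fun x => ?_
    obtain ⟨r, rfl⟩ := Ideal.Quotient.mk_surjective x
    exact (extendScalarsQuotientIso_hom_tmul f _ _ (h u) 1 r).trans
      (congr_arg ((localCohomology.ringModIdeals J).map g)
        (extendScalarsQuotientIso_hom_tmul f _ _ (h t) 1 r)).symm

/-- Flat extension of scalars of the diagram defining local cohomology. -/
noncomputable def localCohomologyDiagramExtendScalarsIso [IsNoetherianRing R] (hf : f.Flat)
    {D : Type} [SmallCategory D] (I : D ⥤ Ideal R)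
    (J : D ⥤ Ideal S) (h : ∀ t, J.obj t = (I.obj t).map f) (n : ℕ) (M : ModuleCat.{0} R) :
    localCohomology.diagram I n ⋙ (evaluation _ _).obj M ⋙ extendScalars f ≅
      localCohomology.diagram J n ⋙ (evaluation _ _).obj ((extendScalars f).obj M) :=
  extendScalarsExtNatIso f hf (localCohomology.ringModIdeals I) M
      (fun t => inferInstanceAs (Module.Finite R (R ⧸ I.obj t))) n ≪≫
    Functor.isoWhiskerRight (Functor.isoWhiskerRight
      (NatIso.op (ringModIdealsExtendScalarsIso f I J h).symm) (Ext S (ModuleCat.{0} S) n)) _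

/-- Local cohomology along a diagram of ideals commutes with flat extension of scalars. -/
noncomputable def localCohomologyOfDiagramExtendScalarsIso [IsNoetherianRing R] (hf : f.Flat)
    {D : Type} [SmallCategory D] (I : D ⥤ Ideal R)
    (J : D ⥤ Ideal S) (h : ∀ t, J.obj t = (I.obj t).map f) (n : ℕ) (M : ModuleCat.{0} R) :
    (extendScalars f).obj ((localCohomology.ofDiagram.{0, 0} I n).obj M) ≅
      (localCohomology.ofDiagram.{0, 0} J n).obj ((extendScalars f).obj M) :=
  (extendScalars f).mapIso (colimitObjIsoColimitCompEvaluation (localCohomology.diagram I n) M) ≪≫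
    preservesColimitIso (extendScalars f) (localCohomology.diagram I n ⋙ (evaluation _ _).obj M) ≪≫
    HasColimit.isoOfNatIso (localCohomologyDiagramExtendScalarsIso f hf I J h n M) ≪≫
    (colimitObjIsoColimitCompEvaluation (localCohomology.diagram J n) _).symm

/-- Local cohomology commutes with flat extension of scalars. -/
noncomputable def localCohomologyExtendScalarsIso [IsNoetherianRing R] (hf : f.Flat)
    (I : Ideal R) (J : Ideal S) (h : J = I.map f) (n : ℕ) (M : ModuleCat.{0} R) :
    (extendScalars f).obj ((localCohomology I n).obj M) ≅
      (localCohomology J n).obj ((extendScalars f).obj M) :=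
  localCohomologyOfDiagramExtendScalarsIso f hf (localCohomology.idealPowersDiagram I)
    (localCohomology.idealPowersDiagram J)
    (fun t => by subst h; exact (Ideal.map_pow f I t.unop).symm) n M

/-- Base change to `B` along `A → B` of an `R`-module, as the restriction to `B` of its base
change along `R → R ⊗[A] B`. -/
noncomputable def tensorRestrictScalarsIso (A R B : Type) [CommRing A] [CommRing R] [Algebra A R]
    [CommRing B] [Algebra A B] (H : ModuleCat.{0} R) :
    ModuleCat.of B (B ⊗[A] (restrictScalars (algebraMap A R)).obj H) ≅
      (restrictScalars ((Algebra.TensorProduct.includeRight : B →ₐ[A] R ⊗[A] B).toRingHom)).obj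
        (ModuleCat.of (R ⊗[A] B) ((R ⊗[A] B) ⊗[R] H)) :=
  letI := Algebra.TensorProduct.rightAlgebra (R := A) (A := R) (B := B)
  letI : Module A H := Module.compHom H (algebraMap A R)
  haveI : IsScalarTower A R H := ⟨fun x y z => by
    rw [Algebra.smul_def, mul_smul]; rfl⟩
  (Algebra.IsPushout.cancelBaseChange A B R (R ⊗[A] B) H).symm.toModuleIso

end ModuleCat

theorem localCohomology_flat_base_change
    (A R B M : Type) [CommRing A] [CommRing R] [Algebra A R] [IsNoetherianRing R]
    [CommRing B] [Algebra A B] [Module.Flat A B]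
    [AddCommGroup M] [Module A M] [Module R M] [IsScalarTower A R M]
    (a : Ideal R) (ha : a.FG) (j : ℕ) :
    Nonempty
      -- `H_a^j(M) ⊗_A B  ≅  H_{a R_B}^j(M_B)` (as `B`-modules) :
      (ModuleCat.of B
          (B ⊗[A] ((ModuleCat.restrictScalars (algebraMap A R)).obj
            ((localCohomology a j).obj (ModuleCat.of R M))))
        ≅ (ModuleCat.restrictScalars
            ((Algebra.TensorProduct.includeRight : B →ₐ[A] R ⊗[A] B).toRingHom)).obj
            ((localCohomology
                (a.map (Algebra.TensorProduct.includeLeft : R →ₐ[A] R ⊗[A] B)) j).obj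
              (ModuleCat.of (R ⊗[A] B) ((R ⊗[A] B) ⊗[R] M)))) := by
  let f := algebraMap R (R ⊗[A] B)
  have hf : f.Flat := (RingHom.flat_algebraMap_iff).2 inferInstance
  let J := a.map (Algebra.TensorProduct.includeLeft : R →ₐ[A] R ⊗[A] B)
  exact ⟨ModuleCat.tensorRestrictScalarsIso A R B _ ≪≫ (ModuleCat.restrictScalars _).mapIso
    ((ModuleCat.extendScalarsObjIso f _ rfl).symm ≪≫
      ModuleCat.localCohomologyExtendScalarsIso f hf a J rfl j (ModuleCat.of R M) ≪≫
      (localCohomology J j).mapIso (ModuleCat.extendScalarsObjIso f (ModuleCat.of R M) rfl))⟩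
end
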